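/- Let S be a domain that is either a complete local Noetherian ring, or finitely generated as an algebra over a field or over ℤ, or, more generally, finitely generated over a Noetherian integrally closed domain R with the property that every finitely generated R-algebra has module-finite integral closure. Let 𝔞_• be a filtration of nonzero ideals in S and let 𝔟 be a nonzero ideal of S. Then ρ̂(𝔞_•, 𝔟^•) = ρ̂(𝔞_•, overline{𝔟^•}) = ρ(𝔞_•, overline{𝔟^•}), where 𝔟^• = {𝔟^i}_{i≥1} and overline{𝔟^•} = {overline{𝔟^i}}_{i≥1}. -/

import Mathlib

open Filter Polynomial
open scoped ENNReal NNReal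

set_option synthInstance.maxHeartbeats 1000000
set_option maxHeartbeats 1000000

universe u

section Preamble

variable {S : Type u} [CommRing S]

/-- A graded family of ideals: `a 0 = S` and `a p * a q ⊆ a (p + q)` for all `p, q`. -/
def GradedFamily (a : ℕ → Ideal S) : Prop :=
  a 0 = ⊤ ∧ ∀ p q : ℕ, a p * a q ≤ a (p + q)

/-- A filtration of ideals: a graded family which is descending. -/
def IdealFiltration (a : ℕ → Ideal S) : Prop :=
  GradedFamily a ∧ ∀ p : ℕ, a (p + 1) ≤ a p

/-- The integral closure of an ideal `I`: the ideal of all elements `x` satisfying an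
equation of integral dependence `x ^ n + c 1 * x ^ (n - 1) + ⋯ + c n = 0` with `c i ∈ I ^ i`. -/
noncomputable def intClosure (I : Ideal S) : Ideal S :=
  Ideal.span {x : S | ∃ n : ℕ, 0 < n ∧ ∃ c : ℕ → S,
    (∀ i, 1 ≤ i → i ≤ n → c i ∈ I ^ i) ∧
    x ^ n + ∑ i ∈ Finset.Icc 1 n, c i * x ^ (n - i) = 0}

/-- The resurgence `ρ(a, b) = sup { s / r : ¬ a s ⊆ b r }` (as an extended real number,
with `sSup ∅ = ⊥`). -/
noncomputable def resurgence (a b : ℕ → Ideal S) : EReal :=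
  sSup {x : EReal | ∃ s r : ℕ, 0 < s ∧ 0 < r ∧ ¬ a s ≤ b r ∧
    x = (((s : ℝ) / (r : ℝ) : ℝ) : EReal)}

/-- The asymptotic resurgence `ρ̂(a, b) = sup { s / r : ¬ a (s*t) ⊆ b (r*t) for all t ≫ 1}`. -/
noncomputable def asympResurgence (a b : ℕ → Ideal S) : EReal :=
  sSup {x : EReal | ∃ s r : ℕ, 0 < s ∧ 0 < r ∧
    (∀ᶠ t : ℕ in atTop, ¬ a (s * t) ≤ b (r * t)) ∧
    x = (((s : ℝ) / (r : ℝ) : ℝ) : EReal)}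

/-- The `k`-th Veronese subalgebra of the Rees algebra of the graded family `b` is a
standard graded `S`-algebra, i.e. `b (k*n) = (b k) ^ n` for all `n ≥ 1`. -/
def StdVeronese (b : ℕ → Ideal S) (k : ℕ) : Prop :=
  ∀ n : ℕ, 1 ≤ n → b (k * n) = b k ^ n

/-- The Rees algebra `ℛ(b) = ⊕ₙ bₙ tⁿ ⊆ S[t]` of a graded family, as a set of polynomials. -/
def ReesSet (b : ℕ → Ideal S) : Set (Polynomial S) :=
  {p : Polynomial S | ∀ n : ℕ, p.coeff n ∈ b n}

/-- `ℛ(b')` is a finitely generated `ℛ(b)`-module: there is a finite set `G ⊆ ℛ(b')`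
such that every element of `ℛ(b')` is an `ℛ(b)`-linear combination of elements of `G`. -/
def ReesFGModule (b b' : ℕ → Ideal S) : Prop :=
  ∃ G : Finset (Polynomial S), (G : Set (Polynomial S)) ⊆ ReesSet b' ∧
    ∀ p ∈ ReesSet b', ∃ c : Polynomial S → Polynomial S,
      (∀ g ∈ G, c g ∈ ReesSet b) ∧ p = ∑ g ∈ G, c g * g

/-- A graded family `b` is `bb`-equivalent (for an ideal `bb`) if for some `k`,
`b (i + k) ⊆ bb ^ i ⊆ b i` for all `i ≥ 1`. -/
def BEquivalent (bb : Ideal S) (b : ℕ → Ideal S) : Prop :=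
  ∃ k : ℕ, ∀ i : ℕ, 1 ≤ i → b (i + k) ≤ bb ^ i ∧ bb ^ i ≤ b i

/-- `β_n(a, b) = inf { d ≥ 1 : ¬ a n ⊆ b d }`, with `inf ∅ = ∞`. -/
noncomputable def betaIdx (a b : ℕ → Ideal S) (n : ℕ) : ℕ∞ :=
  sInf {d : ℕ∞ | ∃ m : ℕ, 0 < m ∧ ¬ a n ≤ b m ∧ d = (m : ℕ∞)}

/-- `ρ^n(a, b) = sup { s / β_s(a, b) : s ≥ n, β_s(a, b) < ∞ }`. -/
noncomputable def rhoN (a b : ℕ → Ideal S) (n : ℕ) : EReal :=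
  sSup {x : EReal | ∃ s d : ℕ, n ≤ s ∧ 0 < s ∧ betaIdx a b s = (d : ℕ∞) ∧
    x = (((s : ℝ) / (d : ℝ) : ℝ) : EReal)}

/-- `ρ^lim(a, b) = lim_{n → ∞} ρ^n(a, b)`, the limit of the nonincreasing sequence `ρ^n`,
i.e. its infimum. -/
noncomputable def rhoLim (a b : ℕ → Ideal S) : EReal :=
  ⨅ n : ℕ, rhoN a b n

end Preamble

section Valuations

variable {S : Type u} [CommRing S] [IsDomain S]

/-- A (discrete) valuation of the quotient field `K` of `S`: a function `v : K → ℤ` with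
`v (x * y) = v x + v y` and `v (x + y) ≥ min (v x) (v y)` (for nonzero elements). -/
structure ValuationOn (S : Type u) [CommRing S] [IsDomain S] where
  v : FractionRing S → ℤ
  map_mul : ∀ x y : FractionRing S, x ≠ 0 → y ≠ 0 → v (x * y) = v x + v y
  min_le_map_add : ∀ x y : FractionRing S, x ≠ 0 → y ≠ 0 → x + y ≠ 0 →
    min (v x) (v y) ≤ v (x + y)

/-- A valuation of the quotient field is supported on `S` if it is nonnegative on `S`. -/
def ValuationOn.Supported (w : ValuationOn S) : Prop :=
  ∀ x : S, x ≠ 0 → 0 ≤ w.v (algebraMap S (FractionRing S) x)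

/-- `v(I) = min { v x : x ∈ I, x ≠ 0 }`. -/
noncomputable def idealVal (w : ValuationOn S) (I : Ideal S) : ℤ :=
  sInf {m : ℤ | ∃ x ∈ I, x ≠ 0 ∧ w.v (algebraMap S (FractionRing S) x) = m}

/-- The skew Waldschmidt constant `v̂(a) = inf_{n ≥ 1} v(a n) / n (= lim_{n → ∞} v(a n)/n)`. -/
noncomputable def skewWald (w : ValuationOn S) (a : ℕ → Ideal S) : ℝ :=
  sInf {t : ℝ | ∃ n : ℕ, 0 < n ∧ t = (idealVal w (a n) : ℝ) / (n : ℝ)}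

/-- `β_n^v(a, b) = inf { d ≥ 1 : v(a n) < v(b d) }`, with `inf ∅ = ∞`. -/
noncomputable def betaVal (w : ValuationOn S) (a b : ℕ → Ideal S) (n : ℕ) : ℕ∞ :=
  sInf {d : ℕ∞ | ∃ m : ℕ, 0 < m ∧ idealVal w (a n) < idealVal w (b m) ∧ d = (m : ℕ∞)}

end Valuations

section Domains

/-- `S` is a finitely generated algebra over a field. -/
structure FieldBase (S : Type u) [CommRing S] where
  F : Type u
  [fld : Field F]
  [alg : Algebra F S]
  fg : Algebra.FiniteType F S

/-- `S` is finitely generated over a Noetherian integrally closed domain `R` with the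
property that every finitely generated `R`-algebra (domain) has module-finite integral
closure (in its fraction field). -/
structure NagataBase (S : Type u) [CommRing S] where
  R : Type u
  [cring : CommRing R]
  [dom : IsDomain R]
  [noeth : IsNoetherianRing R]
  [intClosed : IsIntegrallyClosed R]
  [alg : Algebra R S]
  fg : Algebra.FiniteType R S
  finiteIntegralClosure : ∀ (A : Type u) [CommRing A] [IsDomain A] [Algebra R A],
    Algebra.FiniteType R A → Module.Finite A (integralClosure A (FractionRing A))

/-- `S` is a complete local Noetherian ring, or finitely generated over a field or over `ℤ`,
or, more generally, finitely generated over a Noetherian integrally closed domain `R` such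
that every finitely generated `R`-algebra has a module-finite integral closure. -/
def AdmissibleDomain (S : Type u) [CommRing S] : Prop :=
  (IsNoetherianRing S ∧ ∃ m : Ideal S, m.IsMaximal ∧ (∀ I : Ideal S, I.IsMaximal → I = m) ∧
    IsAdicComplete m S)
  ∨ Nonempty (FieldBase S) ∨ Algebra.FiniteType ℤ S ∨ Nonempty (NagataBase S)

end Domains

section ArtinianModules

variable {R M : Type*} [CommRing R] [AddCommGroup M] [Module R M]

/-- The elements `x ^ k • z` with `z ∈ N` that are killed by `x`. -/
def Submodule.powTorsion (x : R) (N : Submodule R M) (k : ℕ) : Submodule R M :=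
  N.map (LinearMap.lsmul R M (x ^ k)) ⊓ Submodule.torsionBy R M x

theorem Submodule.mem_powTorsion {x : R} {N : Submodule R M} {k : ℕ} {w : M} :
    w ∈ N.powTorsion x k ↔ (∃ z ∈ N, x ^ k • z = w) ∧ x • w = 0 := by
  simp [Submodule.powTorsion, Submodule.mem_map]

theorem Submodule.powTorsion_mono {x : R} {N N' : Submodule R M} (h : N' ≤ N) {k k' : ℕ}
    (hk : k ≤ k') : N'.powTorsion x k' ≤ N.powTorsion x k := by
  intro w hw
  rw [Submodule.mem_powTorsion] at hw ⊢
  obtain ⟨⟨z, hz, rfl⟩, h2⟩ := hw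
  refine ⟨⟨x ^ (k' - k) • z, N.smul_mem _ (h hz), ?_⟩, h2⟩
  rw [smul_smul, ← pow_add, Nat.add_sub_cancel' hk]

theorem Submodule.le_of_powTorsion_le {x : R} (htors : ∀ z : M, ∃ n : ℕ, x ^ n • z = 0)
    {N N' : Submodule R M} (h : N' ≤ N) (hk : ∀ k, N.powTorsion x k ≤ N'.powTorsion x k) :
    N ≤ N' := by
  have key : ∀ n : ℕ, ∀ z ∈ N, x ^ n • z = 0 → z ∈ N' := by
    intro n
    induction n with
    | zero => intro z _ h0; simp at h0; simp [h0]
    | succ n ih =>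
      intro z hz h0
      have h1 : x ^ n • z ∈ N.powTorsion x n :=
        Submodule.mem_powTorsion.2 ⟨⟨z, hz, rfl⟩, by rw [smul_smul, ← pow_succ', h0]⟩
      obtain ⟨⟨w, hw, hwz⟩, -⟩ := Submodule.mem_powTorsion.1 (hk n h1)
      have h2 := ih (z - w) (N.sub_mem hz (h hw)) (by rw [smul_sub, hwz, sub_self])
      simpa using N'.add_mem h2 hw
  intro z hz
  obtain ⟨n, hn⟩ := htors z
  exact key n z hz hn

/-- Melkersson's criterion in the principal case: if every element of `M` is killed by a power
of `x` and the `x`-torsion is Artinian, then `M` is Artinian. -/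
theorem isArtinian_of_torsionBy (x : R) (htors : ∀ z : M, ∃ n : ℕ, x ^ n • z = 0)
    (hart : IsArtinian R (Submodule.torsionBy R M x)) : IsArtinian R M := by
  rw [← monotone_stabilizes_iff_artinian] at hart ⊢
  have stab : ∀ g : ℕ → Submodule R M, Antitone g → (∀ i, g i ≤ Submodule.torsionBy R M x) →
      ∃ n, ∀ m, n ≤ m → g n = g m := by
    intro g hg hle
    obtain ⟨n, hn⟩ := hart ⟨fun i => OrderDual.toDual
      ((g i).comap (Submodule.torsionBy R M x).subtype),
      fun i j hij => Submodule.comap_mono (hg hij)⟩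
    refine ⟨n, fun m hm => ?_⟩
    have e : (g n).comap (Submodule.torsionBy R M x).subtype =
      (g m).comap (Submodule.torsionBy R M x).subtype := hn m hm
    have h2 := congrArg (Submodule.map (Submodule.torsionBy R M x).subtype) e
    rwa [Submodule.map_comap_subtype, Submodule.map_comap_subtype, inf_eq_right.2 (hle n),
      inf_eq_right.2 (hle m)] at h2
  intro f
  have hf : Antitone fun i => OrderDual.ofDual (f i) := fun i j hij => f.monotone hij
  have hg : ∀ N : Submodule R M, ∀ k, N.powTorsion x k ≤ Submodule.torsionBy R M x :=
    fun N k => inf_le_right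
  obtain ⟨n, hn⟩ := stab (fun i => (OrderDual.ofDual (f i)).powTorsion x i)
    (fun i j hij => Submodule.powTorsion_mono (hf hij) hij) (fun i => hg _ _)
  have hcol : ∀ k, ∃ n, ∀ m, n ≤ m → (OrderDual.ofDual (f n)).powTorsion x k =
      (OrderDual.ofDual (f m)).powTorsion x k := fun k =>
    stab (fun i => (OrderDual.ofDual (f i)).powTorsion x k)
      (fun i j hij => Submodule.powTorsion_mono (hf hij) le_rfl) (fun i => hg _ _)
  choose c hc using hcol
  let n' := max n ((Finset.range n).sup c)
  refine ⟨n', fun m hm => ?_⟩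
  have h1 : OrderDual.ofDual (f m) ≤ OrderDual.ofDual (f n') := hf hm
  refine congrArg OrderDual.toDual (le_antisymm ?_ h1 :
    OrderDual.ofDual (f n') = OrderDual.ofDual (f m))
  refine Submodule.le_of_powTorsion_le htors h1 fun k => ?_
  by_cases hk : k < n
  · have hck : c k ≤ n' := le_max_of_le_right (Finset.le_sup (f := c) (Finset.mem_range.2 hk))
    rw [← hc k n' hck, ← hc k m (hck.trans hm)]
  · push Not at hk
    have e1 : (OrderDual.ofDual (f n')).powTorsion x k ≤
        (OrderDual.ofDual (f n)).powTorsion x n :=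
      Submodule.powTorsion_mono (hf (le_max_left _ _)) hk
    refine e1.trans ?_
    rw [hn (max m k) (hk.trans (le_max_right _ _))]
    exact Submodule.powTorsion_mono (hf (le_max_left _ _)) (le_max_right _ _)

theorem isArtinian_of_fg_of_pow_smul_eq_zero [IsNoetherianRing R] [IsLocalRing R]
    (hfg : Module.Finite R M) (n : ℕ)
    (h : ∀ a ∈ IsLocalRing.maximalIdeal R ^ n, ∀ z : M, a • z = 0) : IsArtinian R M := by
  let J := IsLocalRing.maximalIdeal R ^ n
  have htor : Module.IsTorsionBySet R M (J : Set R) := fun z a => h a.1 a.2 z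
  let := htor.module
  have : IsScalarTower R (R ⧸ J) M := htor.isScalarTower
  have : Module.Finite (R ⧸ J) M := Module.Finite.of_restrictScalars_finite R _ _
  by_cases hn : n = 0
  · have : Subsingleton M := ⟨fun a b => by
      have e : ∀ z : M, z = 0 := fun z => by simpa using h 1 (by simp [hn]) z
      rw [e a, e b]⟩
    infer_instance
  · have : Nontrivial (R ⧸ J) := Ideal.Quotient.nontrivial_iff.2 (fun e =>
      (IsLocalRing.maximalIdeal.isMaximal R).ne_top (top_le_iff.1 (e ▸ Ideal.pow_le_self hn)))
    have : IsLocalRing (R ⧸ J) := .of_surjective' (Ideal.Quotient.mk J)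
      Ideal.Quotient.mk_surjective
    have : IsArtinianRing (R ⧸ J) := by
      rw [isArtinianRing_iff_isNilpotent_maximalIdeal]
      refine ⟨n, ?_⟩
      have hm : IsLocalRing.maximalIdeal (R ⧸ J) =
          (IsLocalRing.maximalIdeal R).map (Ideal.Quotient.mk J) := by
        symm
        apply IsLocalRing.eq_maximalIdeal
        exact Ideal.IsMaximal.map_of_surjective_of_ker_le Ideal.Quotient.mk_surjective
          (by rw [Ideal.mk_ker]; exact Ideal.pow_le_self hn)
      rw [hm, ← Ideal.map_pow, Ideal.zero_eq_bot, Ideal.map_quotient_self]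
    have : IsArtinian (R ⧸ J) M := isArtinian_of_fg_of_artinian'
    exact isArtinian_of_surjective_algebraMap (R := R ⧸ J) (S := R) Ideal.Quotient.mk_surjective

end ArtinianModules

section TorsionQuotient

variable {R M : Type*} [CommRing R] [AddCommGroup M] [Module R M]

theorem Module.Finite.exists_pow_smul_eq_zero (J : Ideal R) [Module.Finite R M]
    (h : ∀ z : M, ∃ n : ℕ, ∀ a ∈ J ^ n, a • z = 0) :
    ∃ n : ℕ, ∀ a ∈ J ^ n, ∀ z : M, a • z = 0 := by
  obtain ⟨s, hs⟩ := Module.Finite.fg_top (R := R) (M := M)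
  choose n hn using h
  refine ⟨s.sup n, fun a ha z => ?_⟩
  have hz : z ∈ Submodule.span R (s : Set M) := hs ▸ Submodule.mem_top
  induction hz using Submodule.span_induction with
  | mem z hz => exact hn z a (Ideal.pow_le_pow_right (Finset.le_sup hz) ha)
  | zero => simp
  | add y z _ _ hy hz => rw [smul_add, hy, hz, add_zero]
  | smul r z _ hz => rw [smul_comm, hz, smul_zero]

/-- The elements killed by some power of the ideal `J`. -/
def Submodule.idealTorsion (J : Ideal R) (M : Type*) [AddCommGroup M] [Module R M] :
    Submodule R M where
  carrier := {z | ∃ n : ℕ, ∀ a ∈ J ^ n, a • z = 0}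
  zero_mem' := ⟨0, fun a _ => smul_zero a⟩
  add_mem' := by
    rintro y z ⟨n, hn⟩ ⟨k, hk⟩
    refine ⟨max n k, fun a ha => ?_⟩
    rw [smul_add, hn a (Ideal.pow_le_pow_right (le_max_left _ _) ha),
      hk a (Ideal.pow_le_pow_right (le_max_right _ _) ha), add_zero]
  smul_mem' := by
    rintro r z ⟨n, hn⟩
    exact ⟨n, fun a ha => by rw [smul_comm, hn a ha, smul_zero]⟩

theorem Submodule.mem_idealTorsion {J : Ideal R} {z : M} :
    z ∈ Submodule.idealTorsion J M ↔ ∃ n : ℕ, ∀ a ∈ J ^ n, a • z = 0 := Iff.rfl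

variable {K : Type*} [Field K] [Algebra R K]

theorem isArtinian_idealTorsion_quotient_range [IsDomain R] [IsNoetherianRing R]
    [IsLocalRing R] [IsFractionRing R K] {x : R} (hx : x ∈ IsLocalRing.maximalIdeal R)
    (hx0 : x ≠ 0) :
    IsArtinian R (Submodule.idealTorsion (IsLocalRing.maximalIdeal R)
      (K ⧸ LinearMap.range (Algebra.linearMap R K))) := by
  set T := Submodule.idealTorsion (IsLocalRing.maximalIdeal R)
      (K ⧸ LinearMap.range (Algebra.linearMap R K)) with hT
  have hxK : algebraMap R K x ≠ 0 := by
    simpa using (IsFractionRing.injective R K).ne hx0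
  refine isArtinian_of_torsionBy x ?_ ?_
  · rintro ⟨z, n, hn⟩
    exact ⟨n, Subtype.ext (hn _ (Ideal.pow_mem_pow hx n))⟩
  · let f : R →ₗ[R] (K ⧸ LinearMap.range (Algebra.linearMap R K)) :=
      (Submodule.mkQ _).comp (LinearMap.toSpanSingleton R K (algebraMap R K x)⁻¹)
    let g : Submodule.torsionBy R T x →ₗ[R] LinearMap.range f :=
      LinearMap.codRestrict _ (T.subtype.comp (Submodule.subtype _)) (by
        rintro ⟨⟨z, hz⟩, hzx⟩
        obtain ⟨k, rfl⟩ := Submodule.mkQ_surjective _ z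
        have h1 : Submodule.mkQ (LinearMap.range (Algebra.linearMap R K)) (x • k) = 0 := by
          simpa [Subtype.ext_iff] using hzx
        rw [Submodule.mkQ_apply, Submodule.Quotient.mk_eq_zero] at h1
        obtain ⟨r, hr⟩ := h1
        refine ⟨r, ?_⟩
        have : r • (algebraMap R K x)⁻¹ = k := by
          rw [Algebra.linearMap_apply, Algebra.smul_def] at hr
          rw [Algebra.smul_def, hr]
          field_simp
        simp [f, LinearMap.toSpanSingleton_apply, this])
    have hg : Function.Injective g := by
      intro a b hab
      have := congrArg Subtype.val hab
      exact Subtype.ext (Subtype.ext this)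
    have hfin : Module.Finite R (Submodule.torsionBy R T x) := Module.Finite.of_injective g hg
    obtain ⟨n, hn⟩ := Module.Finite.exists_pow_smul_eq_zero (M := Submodule.torsionBy R T x)
      (IsLocalRing.maximalIdeal R) (by
        rintro ⟨⟨z, n, hn⟩, hzx⟩
        exact ⟨n, fun a ha => Subtype.ext (Subtype.ext (hn a ha))⟩)
    exact isArtinian_of_fg_of_pow_smul_eq_zero hfin n hn

end TorsionQuotient

section OneDimensional

variable {A : Type*} [CommRing A]

theorem Module.Finite.of_isArtinian_of_maximal_smul_eq_zero {M : Type*} [AddCommGroup M]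
    [Module A M] [IsArtinian A M] (m : Ideal A) [m.IsMaximal]
    (h : ∀ a ∈ m, ∀ z : M, a • z = 0) : Module.Finite A M := by
  have htor : Module.IsTorsionBySet A M (m : Set A) := fun z a => h a.1 a.2 z
  let := htor.module
  let := Ideal.Quotient.field m
  have : IsScalarTower A (A ⧸ m) M := htor.isScalarTower
  have : IsArtinian (A ⧸ m) M := isArtinian_of_tower A inferInstance
  have : Module.Finite (A ⧸ m) M := (IsSemisimpleModule.finite_tfae.out 0 2).2 this
  exact Module.Finite.trans (A ⧸ m) M

variable [IsDomain A] [IsNoetherianRing A] [IsLocalRing A]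

theorem IsLocalRing.exists_maximalIdeal_pow_le_span {c : A}
    (hc : IsLocalRing.maximalIdeal A ∈ (Ideal.span {c}).minimalPrimes) {s : A} (hs : s ≠ 0) :
    ∃ n : ℕ, IsLocalRing.maximalIdeal A ^ n ≤ Ideal.span {s} := by
  refine Ideal.exists_pow_le_of_le_radical_of_fg ?_ (IsNoetherian.noetherian _)
  rw [Ideal.radical_eq_sInf]
  refine le_sInf fun p ⟨hsp, hp⟩ => ?_
  have h1 : (IsLocalRing.maximalIdeal A).height ≤ 1 :=
    Ideal.height_le_one_of_isPrincipal_of_mem_minimalPrimes _ _ hc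
  by_contra hlt
  have hlt' : p < IsLocalRing.maximalIdeal A :=
    lt_of_le_of_ne (IsLocalRing.le_maximalIdeal hp.ne_top) (fun e => hlt e.ge)
  have h2 := (Ideal.height_strict_mono_of_isPrime_of_isPrime hlt').trans_le h1
  rw [Order.lt_one_iff, Ideal.height_eq_zero_iff_eq_bot] at h2
  rw [h2] at hsp
  exact hs (by simpa using hsp)

theorem ValuationRing.isNoetherianRing_and_finite_residueField {V : Type*} (K : Type*)
    [CommRing V] [IsDomain V] [ValuationRing V] [Field K] [Algebra A V]
    [Algebra V K] [IsFractionRing V K] [Algebra A K] [IsScalarTower A V K] [IsFractionRing A K]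
    [IsLocalHom (algebraMap A V)] {c : A} (hc0 : c ≠ 0)
    (hc : IsLocalRing.maximalIdeal A ∈ (Ideal.span {c}).minimalPrimes) :
    IsNoetherianRing V ∧ Module.Finite A (IsLocalRing.ResidueField V) := by
  have hcm : c ∈ IsLocalRing.maximalIdeal A := hc.1.2 (Ideal.mem_span_singleton_self c)
  have hcK : algebraMap A K c ≠ 0 := by simpa using (IsFractionRing.injective A K).ne hc0
  set c' := algebraMap A V c with hc'
  have hcV : c' ∈ IsLocalRing.maximalIdeal V :=
    ((IsLocalRing.local_hom_TFAE (algebraMap A V)).out 0 2 rfl rfl).1 inferInstance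
      (Ideal.mem_map_of_mem _ hcm)
  have hc'K : algebraMap V K c' = algebraMap A K c :=
    (IsScalarTower.algebraMap_apply A V K c).symm
  have hart : IsArtinian A (K ⧸ LinearMap.range (Algebra.linearMap A K)) := by
    have h1 := isArtinian_idealTorsion_quotient_range (K := K) hcm hc0
    have h2 : Submodule.idealTorsion (IsLocalRing.maximalIdeal A)
        (K ⧸ LinearMap.range (Algebra.linearMap A K)) = ⊤ := by
      refine eq_top_iff.2 fun z _ => ?_
      obtain ⟨k, rfl⟩ := Submodule.mkQ_surjective _ z
      obtain ⟨r, s, hs, rfl⟩ := IsFractionRing.div_surjective A k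
      obtain ⟨n, hn⟩ :=
        IsLocalRing.exists_maximalIdeal_pow_le_span hc (nonZeroDivisors.ne_zero hs)
      refine ⟨n, fun a ha => ?_⟩
      obtain ⟨b, rfl⟩ := Ideal.mem_span_singleton'.1 (hn ha)
      rw [← map_smul, Submodule.mkQ_apply, Submodule.Quotient.mk_eq_zero]
      have hsK : algebraMap A K s ≠ 0 := by
        simpa using (IsFractionRing.injective A K).ne (nonZeroDivisors.ne_zero hs)
      refine ⟨b * r, ?_⟩
      simp only [Algebra.linearMap_apply, Algebra.smul_def, map_mul]
      field_simp
    rw [h2] at h1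
    exact isArtinian_of_linearEquiv Submodule.topEquiv
  let W : Submodule A K := LinearMap.range (IsScalarTower.toAlgHom A V K).toLinearMap
  have hW : LinearMap.range (Algebra.linearMap A K) ≤ W := by
    rintro _ ⟨r, rfl⟩
    exact ⟨algebraMap A V r, (IsScalarTower.algebraMap_apply A V K r).symm⟩
  have hartW : IsArtinian A (K ⧸ W) :=
    isArtinian_of_surjective _ (Submodule.factor hW) (Submodule.factor_surjective hW)
  let f : V →ₗ[A] (K ⧸ W) := (Submodule.mkQ W).comp
    ((LinearMap.mulRight A (algebraMap A K c)⁻¹).comp (IsScalarTower.toAlgHom A V K).toLinearMap)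
  have hfker : ∀ z : V, f z = 0 → z ∈ Ideal.span {c'} := by
    intro z hz
    simp only [f, LinearMap.comp_apply, Submodule.mkQ_apply, Submodule.Quotient.mk_eq_zero] at hz
    obtain ⟨w, hw⟩ := hz
    refine Ideal.mem_span_singleton'.2 ⟨w, IsFractionRing.injective V K ?_⟩
    simp only [AlgHom.toLinearMap_apply, IsScalarTower.coe_toAlgHom', LinearMap.mulRight_apply]
      at hw
    rw [map_mul, hw, hc'K, mul_assoc, inv_mul_cancel₀ hcK, mul_one]
  have hartQ : IsArtinian A (V ⧸ LinearMap.ker f) :=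
    isArtinian_of_linearEquiv f.quotKerEquivRange.symm
  have hVc : IsArtinian A (V ⧸ Ideal.span {c'}) := by
    let g : (V ⧸ LinearMap.ker f) →ₗ[A] (V ⧸ Ideal.span {c'}) :=
      (LinearMap.ker f).liftQ (Ideal.Quotient.mkₐ A (Ideal.span {c'})).toLinearMap
        (fun z hz => Ideal.Quotient.eq_zero_iff_mem.2 (hfker z hz))
    refine isArtinian_of_surjective _ g fun y => ?_
    obtain ⟨z, rfl⟩ := Ideal.Quotient.mk_surjective y
    exact ⟨Submodule.Quotient.mk z, rfl⟩
  have hringart : IsArtinianRing (V ⧸ Ideal.span {c'}) := isArtinian_of_tower A hVc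
  constructor
  · refine IsNoetherianRing.of_prime fun P hP => ?_
    by_cases hP0 : P = ⊥
    · exact hP0 ▸ Submodule.fg_bot
    obtain ⟨y, hyP, hy0⟩ := Submodule.exists_mem_ne_zero_of_ne_bot hP0
    have hcP : c' ∈ P := by
      obtain ⟨r, s, hs, hrs⟩ := IsFractionRing.div_surjective A (algebraMap V K y)
      have hsK : algebraMap A K s ≠ 0 := by
        simpa using (IsFractionRing.injective A K).ne (nonZeroDivisors.ne_zero hs)
      have hr : r ≠ 0 := by
        rintro rfl
        rw [map_zero, zero_div] at hrs
        exact hy0 (IsFractionRing.injective V K (by rw [← hrs, map_zero]))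
      obtain ⟨n, hn⟩ := IsLocalRing.exists_maximalIdeal_pow_le_span hc hr
      obtain ⟨b, hb⟩ := Ideal.mem_span_singleton'.1 (hn (Ideal.pow_mem_pow hcm n))
      have h3 : c' ^ n = y * (algebraMap A V (b * s)) := by
        apply IsFractionRing.injective V K
        rw [map_pow, hc'K, map_mul, ← hrs, ← IsScalarTower.algebraMap_apply, ← map_pow, ← hb,
          map_mul, map_mul]
        field_simp
      exact hP.mem_of_pow_mem n (h3 ▸ P.mul_mem_right _ hyP)
    have hker : Ideal.span {c'} ≤ P := (Ideal.span_singleton_le_iff_mem _).2 hcP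
    refine Ideal.fg_of_fg_map_of_fg_inf_ker_of_surjective (f := Ideal.Quotient.mk (Ideal.span {c'}))
      (IsNoetherian.noetherian _) ?_ Ideal.Quotient.mk_surjective
    rw [Ideal.mk_ker, inf_eq_right.2 hker]
    exact Submodule.fg_span_singleton c'
  · let g : (V ⧸ LinearMap.ker f) →ₗ[A] IsLocalRing.ResidueField V :=
      (LinearMap.ker f).liftQ (IsScalarTower.toAlgHom A V _).toLinearMap
        (fun z hz => (IsLocalRing.residue_eq_zero_iff z).2
          ((Ideal.span_singleton_le_iff_mem _).2 hcV (hfker z hz)))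
    have : IsArtinian A (IsLocalRing.ResidueField V) := by
      refine isArtinian_of_surjective _ g fun y => ?_
      obtain ⟨z, rfl⟩ := IsLocalRing.residue_surjective y
      exact ⟨Submodule.Quotient.mk z, rfl⟩
    refine Module.Finite.of_isArtinian_of_maximal_smul_eq_zero (IsLocalRing.maximalIdeal A)
      fun a ha z => ?_
    have h5 : algebraMap A V a ∈ IsLocalRing.maximalIdeal V :=
      ((IsLocalRing.local_hom_TFAE (algebraMap A V)).out 0 2 rfl rfl).1 inferInstance
        (Ideal.mem_map_of_mem _ ha)
    rw [Algebra.smul_def, IsScalarTower.algebraMap_apply A V (IsLocalRing.ResidueField V),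
      IsLocalRing.ResidueField.algebraMap_eq, (IsLocalRing.residue_eq_zero_iff _).2 h5, zero_mul]

end OneDimensional

section GoodValuations

open scoped WithZero

theorem IsIntegral.of_mem_adjoin_inv {R K : Type*} [CommRing R] [Field K] [Algebra R K] {b : K}
    (hb0 : b ≠ 0) (hb : b ∈ Algebra.adjoin R {b⁻¹}) : IsIntegral R b := by
  nontriviality R
  rw [Algebra.adjoin_singleton_eq_range_aeval] at hb
  obtain ⟨f, hf⟩ := hb
  have : Invertible (b⁻¹) := invertibleOfNonzero (inv_ne_zero hb0)
  have h := Polynomial.eval₂_reverse_mul_pow (algebraMap R K) (b⁻¹) f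
  have hf' : eval₂ (algebraMap R K) b⁻¹ f = b := hf
  rw [hf', invOf_eq_inv, inv_inv] at h
  have h2 : eval₂ (algebraMap R K) b f.reverse = b ^ (f.natDegree + 1) := by
    calc eval₂ (algebraMap R K) b f.reverse
        = (eval₂ (algebraMap R K) b f.reverse * b⁻¹ ^ f.natDegree) * b ^ f.natDegree := by
          rw [mul_assoc, ← mul_pow, inv_mul_cancel₀ hb0, one_pow, mul_one]
      _ = b ^ (f.natDegree + 1) := by rw [h, pow_succ']
  refine ⟨X ^ (f.natDegree + 1) + (-f.reverse), monic_X_pow_add ?_, ?_⟩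
  · rw [degree_neg]
    refine lt_of_le_of_lt degree_le_natDegree ?_
    exact_mod_cast Nat.lt_succ_of_le (reverse_natDegree_le f)
  · simp [h2]

theorem Valuation.le_one_of_isIntegral {R K Γ : Type*} [CommRing R] [Field K] [Algebra R K]
    [LinearOrderedCommGroupWithZero Γ] (v : Valuation K Γ) (hv : ∀ r : R, v (algebraMap R K r) ≤ 1)
    {b : K} (hb : IsIntegral R b) : v b ≤ 1 := by
  let f : R →+* v.valuationSubring := (algebraMap R K).codRestrict v.valuationSubring hv
  have h : IsIntegral v.valuationSubring b := by
    obtain ⟨p, hp, hpb⟩ := hb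
    refine ⟨p.map f, hp.map f, ?_⟩
    rw [eval₂_map]
    exact hpb
  exact (Valuation.valuationSubring.integers v).isIntegral_iff_v_le_one.1 h

/-- A valuation of `K` with values in `ℤ`, nonnegative on `D`, whose residue field is finite over
the fraction field of the image of `D`. -/
def IsGoodValuation (D : Type*) {K : Type*} [CommRing D] [Field K] [Algebra D K]
    (v : Valuation K ℤᵐ⁰) : Prop :=
  (∀ d : D, v (algebraMap D K d) ≤ 1) ∧
    ∃ t : Finset K, (∀ z ∈ t, v z ≤ 1) ∧ ∀ k : K, v k ≤ 1 →
      ∃ s : D, v (algebraMap D K s) = 1 ∧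
        ∃ z ∈ Submodule.span D (t : Set K), v (algebraMap D K s * k - z) < 1

variable {R K : Type*} [CommRing R] [IsNoetherianRing R] [IsLocalRing R] [Field K]
  [Algebra R K] [IsFractionRing R K]

theorem exists_isGoodValuation_of_not_isIntegral {b : K} (hb : ¬ IsIntegral R b)
    (hmb : ∀ a ∈ IsLocalRing.maximalIdeal R, IsIntegral R (algebraMap R K a * b)) :
    ∃ v : Valuation K ℤᵐ⁰, IsGoodValuation R v ∧
      (∀ a ∈ IsLocalRing.maximalIdeal R, v (algebraMap R K a) < 1) ∧ 1 < v b := by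
  have hb0 : b ≠ 0 := fun h => hb (h ▸ isIntegral_zero)
  let C : Subalgebra R K := Algebra.adjoin R {b⁻¹}
  have hCfg : Algebra.FiniteType R C := by
    refine (Subalgebra.fg_iff_finiteType C).1 ?_
    have := Subalgebra.fg_adjoin_finset (R := R) ({b⁻¹} : Finset K)
    rwa [Finset.coe_singleton] at this
  have hCN : IsNoetherianRing C := Algebra.FiniteType.isNoetherianRing R C
  let C' : Subring K := C.toSubring
  have hC'N : IsNoetherianRing C' := hCN
  let c : C' := ⟨b⁻¹, Algebra.subset_adjoin rfl⟩
  have hc0 : c ≠ 0 := fun h => inv_ne_zero hb0 (congrArg Subtype.val h)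
  have hcu : ¬ IsUnit c := by
    intro h
    obtain ⟨d, hd⟩ := h.exists_right_inv
    have : (d : K) = b := by
      have := congrArg Subtype.val hd
      change b⁻¹ * (d : K) = 1 at this
      field_simp at this
      exact this
    have hd2 : (d : K) ∈ C := d.2
    rw [this] at hd2
    exact hb (IsIntegral.of_mem_adjoin_inv hb0 hd2)
  obtain ⟨q, hq⟩ := (Ideal.span {c}).nonempty_minimalPrimes (by
    rwa [Ne, Ideal.span_singleton_eq_top])
  have hqp : q.IsPrime := hq.1.1
  let A := (LocalSubring.ofPrime C' q).toSubring
  have hAloc : IsLocalRing A := (LocalSubring.ofPrime C' q).isLocalRing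
  have hAq : IsLocalization.AtPrime A q :=
    inferInstanceAs (IsLocalization.AtPrime (LocalSubring.ofPrime C' q).toSubring q)
  have hAN : IsNoetherianRing A := IsLocalization.isNoetherianRing q.primeCompl A inferInstance
  have hCA : C' ≤ A := LocalSubring.le_ofPrime C' q
  have hRC : ∀ r : R, algebraMap R K r ∈ C' := fun r => C.algebraMap_mem r
  have hAK : IsFractionRing A K := by
    refine IsFractionRing.of_field A K fun z => ?_
    obtain ⟨r, s, hs, rfl⟩ := IsFractionRing.div_surjective R z
    exact ⟨⟨_, hCA (hRC r)⟩, ⟨_, hCA (hRC s)⟩, rfl⟩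
  have hmin : IsLocalRing.maximalIdeal A ∈
      (Ideal.span {algebraMap C' A c}).minimalPrimes := by
    have h := IsLocalization.minimalPrimes_map q.primeCompl A (Ideal.span {c})
    rw [Ideal.map_span, Set.image_singleton] at h
    rw [h, Set.mem_preimage, IsLocalization.AtPrime.under_maximalIdeal A q]
    exact hq
  obtain ⟨V, hAV, hlocal⟩ := (LocalSubring.ofPrime C' q).exists_le_valuationSubring
  let : Algebra A V := (Subring.inclusion hAV : A →+* V.toSubring).toAlgebra
  have : IsScalarTower A V K := .of_algebraMap_eq fun _ => rfl
  have : IsLocalHom (algebraMap A V) := hlocal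
  have hcA0 : algebraMap C' A c ≠ 0 := fun h =>
    hc0 (Subtype.ext (congrArg (Subtype.val : A → K) h))
  obtain ⟨hVN, hfin⟩ := ValuationRing.isNoetherianRing_and_finite_residueField K (V := V)
    hcA0 hmin
  have hcV : algebraMap A V (algebraMap C' A c) ∈ IsLocalRing.maximalIdeal V :=
    ((IsLocalRing.local_hom_TFAE (algebraMap A V)).out 0 2 rfl rfl).1 inferInstance
      (Ideal.mem_map_of_mem _ (hmin.1.2 (Ideal.mem_span_singleton_self _)))
  have hDVR : IsDiscreteValuationRing V :=
    { not_a_field' := fun h => hcA0 (Subtype.ext (by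
        rw [h, Ideal.mem_bot] at hcV
        exact congrArg (Subtype.val : V → K) hcV)) }
  let v : Valuation K ℤᵐ⁰ := (IsDiscreteValuationRing.maximalIdeal V).valuation K
  have hvV : ∀ z : V, v z ≤ 1 := fun z =>
    (IsDiscreteValuationRing.maximalIdeal V).valuation_le_one z
  have hvm : ∀ z : V, v z < 1 ↔ z ∈ IsLocalRing.maximalIdeal V := fun z =>
    (IsDiscreteValuationRing.maximalIdeal V).valuation_lt_one_iff_mem z
  have hVv : ∀ k : K, v k ≤ 1 → k ∈ V := fun k hk => by
    obtain ⟨z, rfl⟩ := IsDiscreteValuationRing.exists_lift_of_le_one hk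
    exact z.2
  have hvC : ∀ f ∈ C', v f ≤ 1 := fun f hf => hvV ⟨f, hAV (hCA hf)⟩
  have hvR : ∀ r : R, v (algebraMap R K r) ≤ 1 := fun r => hvC _ (hRC r)
  have hvb' : v b⁻¹ < 1 := (hvm (algebraMap A V (algebraMap C' A c))).2 hcV
  have hvb : 1 < v b := by
    rw [map_inv₀] at hvb'
    exact (inv_lt_one₀ (zero_lt_iff.2 ((Valuation.ne_zero_iff v).2 hb0))).1 hvb'
  have hvmR : ∀ a ∈ IsLocalRing.maximalIdeal R, v (algebraMap R K a) < 1 := by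
    intro a ha
    have h1 := v.le_one_of_isIntegral hvR (hmb a ha)
    have h2 : algebraMap R K a = (algebraMap R K a * b) * b⁻¹ := by field_simp
    rw [h2, map_mul]
    exact mul_lt_of_le_one_of_lt h1 hvb'
  have hunit : ∀ u : R, v (algebraMap R K u) = 1 → IsUnit u := fun u hu => by
    by_contra h
    exact (hvmR u h).ne hu
  have happC : ∀ f ∈ C, ∃ r : R, v (f - algebraMap R K r) < 1 := by
    intro f hf
    induction hf using Algebra.adjoin_induction with
    | mem x hx =>
      rw [Set.mem_singleton_iff] at hx
      exact ⟨0, by simpa [hx] using hvb'⟩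
    | algebraMap r => exact ⟨r, by simp⟩
    | add x y _ _ hx hy =>
      obtain ⟨r, hr⟩ := hx
      obtain ⟨s, hs⟩ := hy
      refine ⟨r + s, ?_⟩
      rw [map_add, add_sub_add_comm]
      exact v.map_add_lt hr hs
    | mul x y hxC _ hx hy =>
      obtain ⟨r, hr⟩ := hx
      obtain ⟨s, hs⟩ := hy
      refine ⟨r * s, ?_⟩
      rw [map_mul, show x * y - algebraMap R K r * algebraMap R K s =
        x * (y - algebraMap R K s) + algebraMap R K s * (x - algebraMap R K r) by ring]
      refine v.map_add_lt ?_ ?_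
      · rw [map_mul]; exact mul_lt_of_le_one_of_lt (hvC x hxC) hs
      · rw [map_mul]; exact mul_lt_of_le_one_of_lt (hvR s) hr
  have happA : ∀ a : A, ∃ r : R, v ((a : K) - algebraMap R K r) < 1 := by
    intro a
    obtain ⟨⟨f, g⟩, hfg⟩ := IsLocalization.surj q.primeCompl a
    have hfgK : (a : K) * (g : C') = f := congrArg Subtype.val hfg
    have hg : v ((g : C') : K) = 1 := by
      have hu : IsUnit (algebraMap A V (algebraMap C' A g)) :=
        (IsLocalization.map_units A g).map (algebraMap A V)
      have h1 := mt (hvm (algebraMap A V (algebraMap C' A g))).1 (fun h => h hu)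
      exact le_antisymm (hvC _ (g : C').2) (not_lt.1 h1)
    obtain ⟨r, hr⟩ := happC f f.2
    obtain ⟨s, hs⟩ := happC (g : C') (g : C').2
    have hvs : v (algebraMap R K s) = 1 := by
      have := v.map_sub_eq_of_lt_right (x := ((g : C') : K) - algebraMap R K s)
        (y := ((g : C') : K)) (by rw [hg]; exact hs)
      rw [hg] at this
      rw [← this, ← v.map_neg]
      congr 1; ring
    obtain ⟨u, rfl⟩ := hunit s hvs
    refine ⟨r * (↑u⁻¹ : R), ?_⟩
    have hus : algebraMap R K u * algebraMap R K (↑u⁻¹ : R) = 1 := by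
      rw [← map_mul, Units.mul_inv, map_one]
    rw [show (a : K) - algebraMap R K (r * (↑u⁻¹ : R)) = algebraMap R K (↑u⁻¹ : R) *
      (((f : K) - algebraMap R K r) - a * (((g : C') : K) - algebraMap R K u)) by
        rw [map_mul]
        linear_combination (-(a : K)) * hus + algebraMap R K (↑u⁻¹ : R) * hfgK, map_mul]
    refine mul_lt_of_le_one_of_lt (hvR _) (v.map_sub_lt hr ?_)
    rw [map_mul]
    exact mul_lt_of_le_one_of_lt (hvV (algebraMap A V a)) hs
  refine ⟨v, ⟨hvR, ?_⟩, hvmR, hvb⟩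
  obtain ⟨S, hS⟩ := hfin.fg_top
  choose g hg using IsLocalRing.residue_surjective (R := V)
  classical
  refine ⟨S.image fun y => (g y : K), ?_, fun k hk => ⟨1, by simp, ?_⟩⟩
  · intro z hz
    obtain ⟨y, -, rfl⟩ := Finset.mem_image.1 hz
    exact hvV _
  set T := Submodule.span R ((S.image fun y => (g y : K) : Finset K) : Set K)
  have key : ∀ y : IsLocalRing.ResidueField V, ∃ z ∈ T, ∃ hz : z ∈ V,
      IsLocalRing.residue V ⟨z, hz⟩ = y := by
    intro y
    have hy : y ∈ Submodule.span A (S : Set (IsLocalRing.ResidueField V)) :=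
      hS ▸ Submodule.mem_top
    induction hy using Submodule.span_induction with
    | mem y hy =>
      exact ⟨g y, Submodule.subset_span (Finset.mem_coe.2 (Finset.mem_image_of_mem _ hy)),
        (g y).2, hg y⟩
    | zero => exact ⟨0, T.zero_mem, V.zero_mem, map_zero _⟩
    | add y y' _ _ hy hy' =>
      obtain ⟨z, hz, hzV, rfl⟩ := hy
      obtain ⟨z', hz', hzV', rfl⟩ := hy'
      exact ⟨z + z', T.add_mem hz hz', V.add_mem _ _ hzV hzV', by rw [← map_add]; rfl⟩
    | smul a y _ hy =>
      obtain ⟨z, hz, hzV, rfl⟩ := hy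
      obtain ⟨r, hr⟩ := happA a
      have hrV : algebraMap R K r ∈ V := hVv _ (hvR r)
      refine ⟨r • z, T.smul_mem r hz, ?_, ?_⟩
      · rw [Algebra.smul_def]; exact V.mul_mem _ _ hrV hzV
      · have h1 : IsLocalRing.residue V (algebraMap A V a) = IsLocalRing.residue V ⟨_, hrV⟩ := by
          rw [← sub_eq_zero, ← map_sub, IsLocalRing.residue_eq_zero_iff, ← hvm]
          exact hr
        have h2 : a • IsLocalRing.residue V ⟨z, hzV⟩ =
            IsLocalRing.residue V ⟨_, hrV⟩ * IsLocalRing.residue V ⟨z, hzV⟩ := by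
          rw [Algebra.smul_def, IsScalarTower.algebraMap_apply A V (IsLocalRing.ResidueField V),
            IsLocalRing.ResidueField.algebraMap_eq, h1]
        rw [h2, ← map_mul]
        exact congrArg _ (Subtype.ext (Algebra.smul_def r z))
  obtain ⟨z, hz, hzV, hzk⟩ := key (IsLocalRing.residue V ⟨k, hVv k hk⟩)
  refine ⟨z, hz, ?_⟩
  rw [eq_comm, ← sub_eq_zero, ← map_sub, IsLocalRing.residue_eq_zero_iff, ← hvm] at hzk
  rw [map_one, one_mul]
  exact hzk

end GoodValuations

section FiniteCriterion

open scoped WithZero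

theorem WithZero.not_forall_mul_pow_le_one {d g : ℤᵐ⁰} (hd : d ≠ 0) (hg : 1 < g) :
    ¬ ∀ n : ℕ, d * g ^ n ≤ 1 := by
  intro h
  obtain ⟨n, hn⟩ := MulArchimedean.arch (d⁻¹ * g) hg
  have h1 : g ≤ d * g ^ n := by
    calc g = d * (d⁻¹ * g) := by rw [mul_inv_cancel_left₀ hd]
      _ ≤ d * g ^ n := by gcongr
  exact absurd (h1.trans (h n)) (not_le.2 hg)

/-- The elements of `K` on which all good valuations from a given set are nonnegative. -/
def goodRing (R : Type*) {K : Type*} [CommRing R] [Field K] [Algebra R K]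
    (F : Set (Valuation K ℤᵐ⁰)) : Submodule R K where
  carrier := {k | ∀ v ∈ F, IsGoodValuation R v → v k ≤ 1}
  zero_mem' := fun v _ _ => by simp
  add_mem' := fun ha hb v hv hg => v.map_add_le (ha v hv hg) (hb v hv hg)
  smul_mem' := fun r k hk v hv hg => by
    rw [Algebra.smul_def, map_mul]
    exact mul_le_one' (hg.1 r) (hk v hv hg)

theorem exists_common_denominator_of_fg {R K : Type*} [CommRing R] [IsDomain R] [Field K]
    [Algebra R K] [IsFractionRing R K] {N : Submodule R K} (hN : N.FG) :
    ∃ d : R, d ≠ 0 ∧ ∀ z ∈ N, ∃ r : R, algebraMap R K r = algebraMap R K d * z := by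
  obtain ⟨d, hd, h⟩ := FractionalIdeal.isFractional_of_fg (S := nonZeroDivisors R) hN
  refine ⟨d, nonZeroDivisors.ne_zero hd, fun z hz => ?_⟩
  obtain ⟨r, hr⟩ := h z hz
  exact ⟨r, by rw [hr, Algebra.smul_def]⟩

theorem exists_ne_zero_mul_pow_mem {R K : Type*} [CommRing R] [IsDomain R] [IsNoetherianRing R]
    [Field K] [Algebra R K] [IsFractionRing R K] (J : Ideal R) {b : K}
    (hb : ∀ a ∈ J, IsIntegral R (algebraMap R K a * b)) :
    ∃ d : R, d ≠ 0 ∧ ∀ n : ℕ, ∀ a ∈ J ^ n, ∃ r : R,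
      algebraMap R K r = algebraMap R K d * (algebraMap R K a * b ^ n) := by
  obtain ⟨s, hs⟩ := (isNoetherianRing_iff_ideal_fg R).1 inferInstance J
  have hsub : ∀ a ∈ s, a ∈ J := fun a ha => hs ▸ Ideal.subset_span ha
  let A := Algebra.adjoin R ((fun a => algebraMap R K a * b) '' (s : Set R))
  have hfg : (Subalgebra.toSubmodule A).FG := by
    refine fg_adjoin_of_finite (s.finite_toSet.image _) ?_
    rintro _ ⟨a, ha, rfl⟩
    exact hb a (hsub a ha)
  have h1 : ∀ a ∈ J, algebraMap R K a * b ∈ A := by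
    intro a ha
    rw [← hs] at ha
    induction ha using Submodule.span_induction with
    | mem a ha => exact Algebra.subset_adjoin ⟨a, ha, rfl⟩
    | zero => simp
    | add y z _ _ hy hz => rw [map_add, add_mul]; exact add_mem hy hz
    | smul r z _ hz =>
      rw [smul_eq_mul, map_mul, mul_assoc, ← Algebra.smul_def]
      exact A.smul_mem hz r
  have h2 : ∀ n : ℕ, ∀ a ∈ J ^ n, algebraMap R K a * b ^ n ∈ A := by
    intro n
    induction n with
    | zero => intro a _; simp
    | succ n ih =>
      intro a ha
      rw [pow_succ] at ha
      induction ha using Submodule.mul_induction_on' with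
      | mem_mul_mem y hy z hz =>
        have := A.mul_mem (ih y hy) (h1 z hz)
        rw [map_mul, pow_succ]
        convert this using 1
        ring
      | add y _ z _ hy hz => rw [map_add, add_mul]; exact add_mem hy hz
  obtain ⟨d, hd0, hd⟩ := exists_common_denominator_of_fg hfg
  exact ⟨d, hd0, fun n a ha => hd _ (h2 n a ha)⟩

theorem IsLocalRing.exists_finite_isGoodValuation {R : Type*} (K : Type*) [CommRing R] [IsDomain R]
    [IsNoetherianRing R] [IsLocalRing R] [Field K] [Algebra R K] [IsFractionRing R K] {x : R}
    (hx : x ∈ maximalIdeal R) (hx0 : x ≠ 0) :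
    ∃ F : Set (Valuation K ℤᵐ⁰), F.Finite ∧
      (∀ v ∈ F, IsGoodValuation R v ∧ ∀ a ∈ maximalIdeal R, v (algebraMap R K a) < 1) ∧
      ∀ b : K, (∀ a ∈ maximalIdeal R, IsIntegral R (algebraMap R K a * b)) →
        (∀ v ∈ F, v b ≤ 1) → IsIntegral R b := by
  let L := LinearMap.range (Algebra.linearMap R K)
  let T := Submodule.idealTorsion (maximalIdeal R) (K ⧸ L)
  have hart : IsArtinian R T := isArtinian_idealTorsion_quotient_range (K := K) hx hx0
  let N : Set (Valuation K ℤᵐ⁰) → Submodule R T := fun F =>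
    ((goodRing R F).map L.mkQ).comap T.subtype
  let P : Set (Valuation K ℤᵐ⁰) → Prop := fun F => F.Finite ∧
      (∀ v ∈ F, IsGoodValuation R v ∧ ∀ a ∈ maximalIdeal R, v (algebraMap R K a) < 1)
  obtain ⟨_, ⟨F, hF, rfl⟩, hmin⟩ := IsArtinian.set_has_minimal (N '' {F | P F})
    ⟨_, ∅, ⟨Set.finite_empty, by simp⟩, rfl⟩
  refine ⟨F, hF.1, hF.2, fun b hb hvb => ?_⟩
  by_contra hnb
  obtain ⟨v, hv, hvm, hvb'⟩ := exists_isGoodValuation_of_not_isIntegral hnb hb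
  have hPi : P (insert v F) := by
    refine ⟨hF.1.insert v, ?_⟩
    rintro w (rfl | hw)
    · exact ⟨hv, hvm⟩
    · exact hF.2 w hw
  have hle : N (insert v F) ≤ N F :=
    Submodule.comap_mono (Submodule.map_mono fun k hk w hw hg => hk w (Or.inr hw) hg)
  have heq : N F ≤ N (insert v F) := by
    by_contra hnot
    exact hmin _ ⟨_, hPi, rfl⟩ (lt_of_le_not_ge hle hnot)
  obtain ⟨d, hd0, hd⟩ := exists_ne_zero_mul_pow_mem (maximalIdeal R) hb
  refine WithZero.not_forall_mul_pow_le_one (d := v (algebraMap R K d)) ?_ hvb' ?_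
  · rw [Valuation.ne_zero_iff]
    exact (map_ne_zero_iff _ (IsFractionRing.injective R K)).2 hd0
  intro n
  have hmem : L.mkQ (algebraMap R K d * b ^ n) ∈ T := by
    rw [Submodule.mem_idealTorsion]
    refine ⟨n, fun a ha => ?_⟩
    obtain ⟨r, hr⟩ := hd n a ha
    rw [← map_smul, Submodule.mkQ_apply, Submodule.Quotient.mk_eq_zero]
    refine ⟨r, ?_⟩
    rw [Algebra.linearMap_apply, hr, Algebra.smul_def]
    ring
  have h1 : (⟨_, hmem⟩ : T) ∈ N F := by
    refine ⟨_, ?_, rfl⟩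
    intro w hw hg
    rw [map_mul, map_pow]
    exact mul_le_one' (hg.1 d) (pow_le_one' (hvb w hw) n)
  obtain ⟨k, hk, hkeq⟩ := heq h1
  have h2 : L.mkQ k = L.mkQ (algebraMap R K d * b ^ n) := hkeq
  have h3 := (Submodule.Quotient.eq L).1 h2
  obtain ⟨r, hr⟩ := h3
  rw [Algebra.linearMap_apply] at hr
  have h4 : algebraMap R K d * b ^ n = k - algebraMap R K r := by rw [hr]; ring
  rw [← map_pow, ← map_mul, h4]
  exact v.map_sub_le (hk v (Or.inl rfl) hv) (hv.1 r)

end FiniteCriterion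

section GlobalCriterion

open scoped WithZero

variable {D : Type*} [CommRing D] [IsNoetherianRing D]

theorem Ideal.exists_notMem_forall_mul_mem (p I N : Ideal D) [p.IsPrime]
    (h : ∀ a ∈ I, ∃ s ∉ p, s * a ∈ N) : ∃ s ∉ p, ∀ a ∈ I, s * a ∈ N := by
  classical
  obtain ⟨t, rfl⟩ := (isNoetherianRing_iff_ideal_fg D).1 inferInstance I
  have key : ∀ u : Finset D, u ⊆ t → ∃ s ∉ p, ∀ a ∈ u, s * a ∈ N := by
    intro u
    induction u using Finset.induction_on with
    | empty => exact fun _ => ⟨1, p.ne_top_iff_one.1 (Ideal.IsPrime.ne_top ‹_›), by simp⟩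
    | insert a u _ ih =>
      intro hu
      obtain ⟨s, hs, hsu⟩ := ih fun z hz => hu (Finset.mem_insert_of_mem hz)
      obtain ⟨s', hs', hsa⟩ := h a (Ideal.subset_span (hu (Finset.mem_insert_self a u)))
      refine ⟨s * s', fun hc => (Ideal.IsPrime.mem_or_mem ‹_› hc).elim hs hs', fun z hz => ?_⟩
      rcases Finset.mem_insert.1 hz with rfl | hz
      · rw [mul_assoc]; exact N.mul_mem_left _ hsa
      · rw [mul_right_comm]; exact N.mul_mem_right _ (hsu z hz)
  obtain ⟨s, hs, hst⟩ := key t subset_rfl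
  refine ⟨s, hs, fun a ha => ?_⟩
  induction ha using Submodule.span_induction with
  | mem a ha => exact hst a ha
  | zero => simp
  | add y z _ _ hy hz => rw [mul_add]; exact add_mem hy hz
  | smul r z _ hz => rw [smul_eq_mul, mul_left_comm]; exact N.mul_mem_left _ hz

variable {K : Type*} [Field K] [Algebra D K] [IsFractionRing D K]

/-- The ideal of denominators of `y`. -/
def denomIdeal (D : Type*) {K : Type*} [CommRing D] [Field K] [Algebra D K] (y : K) : Ideal D :=
  (LinearMap.range (Algebra.linearMap D K)).comap (LinearMap.toSpanSingleton D K y)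

theorem mem_denomIdeal {D K : Type*} [CommRing D] [Field K] [Algebra D K] {y : K} {a : D} :
    a ∈ denomIdeal D y ↔ ∃ d : D, algebraMap D K d = algebraMap D K a * y := by
  simp [denomIdeal, Algebra.smul_def]

theorem mul_mem_denomIdeal {D K : Type*} [CommRing D] [Field K] [Algebra D K] {y : K} {a s : D} :
    s * a ∈ denomIdeal D y ↔ a ∈ denomIdeal D (algebraMap D K s * y) := by
  simp only [mem_denomIdeal, map_mul]
  simp only [mul_left_comm, mul_assoc]

theorem mem_associatedPrimes_of_denomIdeal_eq {p : Ideal D} [hp : p.IsPrime] {x : D}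
    (hxp : x ∈ p) (hx0 : x ≠ 0) {y : K} (hy : denomIdeal D y = p) :
    p ∈ associatedPrimes D (D ⧸ Ideal.span {x}) := by
  obtain ⟨w, hw⟩ := mem_denomIdeal.1 (hy ▸ hxp : x ∈ denomIdeal D y)
  rw [AssociatedPrimes.mem_iff, isAssociatedPrime_iff]
  refine ⟨hp, Ideal.Quotient.mk _ w, ?_⟩
  ext a
  have hxK : algebraMap D K x ≠ 0 := (map_ne_zero_iff _ (IsFractionRing.injective D K)).2 hx0
  rw [Submodule.mem_colon_singleton, ← hy, mem_denomIdeal, Submodule.mem_bot,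
    ← Ideal.Quotient.mk_eq_mk, ← Submodule.Quotient.mk_smul, Submodule.Quotient.mk_eq_zero,
    Ideal.mem_span_singleton, smul_eq_mul]
  constructor
  · rintro ⟨d, hd⟩
    refine ⟨d, IsFractionRing.injective D K ?_⟩
    rw [map_mul, map_mul, hd, hw]
    ring
  · rintro ⟨d, hd⟩
    refine ⟨d, mul_left_cancel₀ hxK ?_⟩
    rw [← map_mul, ← hd, map_mul, hw]
    ring

theorem mem_associatedPrimes_of_pow_le_denomIdeal {p : Ideal D} [hp : p.IsPrime] {x : D}
    (hxp : x ∈ p) (hx0 : x ≠ 0) (n : ℕ) {y : K} (hn : p ^ n ≤ denomIdeal D y)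
    (hy : denomIdeal D y ≤ p) : p ∈ associatedPrimes D (D ⧸ Ideal.span {x}) := by
  induction n generalizing y with
  | zero =>
    rw [pow_zero, Ideal.one_eq_top, top_le_iff] at hn
    rw [hn, top_le_iff] at hy
    exact absurd hy hp.ne_top
  | succ n ih =>
    by_cases h : ∃ a ∈ p ^ n, denomIdeal D (algebraMap D K a * y) ≤ p
    · obtain ⟨a, ha, hle⟩ := h
      refine mem_associatedPrimes_of_denomIdeal_eq hxp hx0 (le_antisymm hle fun c hc => ?_)
      rw [← mul_mem_denomIdeal]
      exact hn (pow_succ p n ▸ Ideal.mul_mem_mul ha hc)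
    · have h' : ∀ a ∈ p ^ n, ∃ s ∉ p, s * a ∈ denomIdeal D y := by
        intro a ha
        by_contra! hc
        refine h ⟨a, ha, fun s hs => ?_⟩
        by_contra hsp
        refine hc s hsp ?_
        rw [mul_comm]
        exact mul_mem_denomIdeal.2 hs
      obtain ⟨s, hsp, hs⟩ := Ideal.exists_notMem_forall_mul_mem _ _ _ h'
      refine ih (y := algebraMap D K s * y) (fun a ha => mul_mem_denomIdeal.1 (hs a ha)) ?_
      intro c hc
      exact (hp.mem_or_mem (hy (mul_mem_denomIdeal.2 hc))).resolve_left hsp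

variable [IsDomain D]

theorem mem_associatedPrimes_of_not_isIntegral {p : Ideal D} [hp : p.IsPrime] {x : D}
    (hxp : x ∈ p) (hx0 : x ≠ 0) {b : K} (hb : ∀ a ∈ p, IsIntegral D (algebraMap D K a * b))
    (hn : ∀ s ∉ p, ¬ IsIntegral D (algebraMap D K s * b)) :
    p ∈ associatedPrimes D (D ⧸ Ideal.span {x}) := by
  by_contra hass
  obtain ⟨d, hd0, hd⟩ := exists_ne_zero_mul_pow_mem p hb
  let R := Localization.subalgebra.ofField K p.primeCompl p.primeCompl_le_nonZeroDivisors
  have hR : IsNoetherianRing R := IsLocalization.isNoetherianRing p.primeCompl R inferInstance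
  have hInt : IsIntegral R b := by
    refine IsAlmostIntegral.isIntegral_of_nonZeroDivisors_le_comap
      ⟨algebraMap D R d, mem_nonZeroDivisors_of_ne_zero ?_, fun n => ?_⟩ ?_
    · exact (map_ne_zero_iff _ (FaithfulSMul.algebraMap_injective D R)).2 hd0
    · have hnot : ¬ denomIdeal D (algebraMap D K d * b ^ n) ≤ p := by
        intro hle
        refine hass (mem_associatedPrimes_of_pow_le_denomIdeal hxp hx0 n (fun a ha => ?_) hle)
        obtain ⟨r, hr⟩ := hd n a ha
        exact mem_denomIdeal.2 ⟨r, by rw [hr]; ring⟩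
      obtain ⟨s, hs, hsp⟩ := Set.not_subset.1 hnot
      obtain ⟨r, hr⟩ := mem_denomIdeal.1 hs
      have hs0 : algebraMap D K s ≠ 0 :=
        (map_ne_zero_iff _ (IsFractionRing.injective D K)).2 fun h => hsp (h ▸ p.zero_mem)
      refine ⟨⟨algebraMap D K r * (algebraMap D K s)⁻¹, r, s, hsp, rfl⟩, ?_⟩
      change algebraMap D K r * (algebraMap D K s)⁻¹ = _
      rw [algebraMap_smul, Algebra.smul_def, hr]
      field_simp
    · intro r hr
      exact mem_nonZeroDivisors_of_ne_zero
        ((map_ne_zero_iff _ (FaithfulSMul.algebraMap_injective R K)).2 (nonZeroDivisors.ne_zero hr))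
  obtain ⟨s, hs⟩ := IsIntegral.exists_multiple_integral_of_isLocalization p.primeCompl b hInt
  refine hn s.1 s.2 ?_
  rwa [Submonoid.smul_def, Algebra.smul_def] at hs

theorem IsGoodValuation.of_isLocalization {D R K : Type*} [CommRing D] [CommRing R] [Field K]
    [Algebra D R] [Algebra R K] [Algebra D K] [IsScalarTower D R K] (M : Submonoid D)
    [IsLocalization M R] {v : Valuation K ℤᵐ⁰} (hv : IsGoodValuation R v) :
    IsGoodValuation D v := by
  have hD : ∀ d : D, v (algebraMap D K d) ≤ 1 := fun d => by
    rw [IsScalarTower.algebraMap_apply D R K]; exact hv.1 _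
  have hM : ∀ m : M, v (algebraMap D K m) = 1 := by
    intro m
    refine le_antisymm (hD _) ?_
    obtain ⟨u, hu⟩ := (IsLocalization.map_units R m).exists_right_inv
    have h1 : v (algebraMap D K m) * v (algebraMap R K u) = 1 := by
      rw [IsScalarTower.algebraMap_apply D R K, ← map_mul, ← map_mul, hu, map_one, map_one]
    calc 1 = v (algebraMap D K m) * v (algebraMap R K u) := h1.symm
      _ ≤ v (algebraMap D K m) * 1 := by gcongr; exact hv.1 u
      _ = _ := mul_one _
  obtain ⟨t, ht1, ht⟩ := hv.2
  refine ⟨hD, t, ht1, fun k hk => ?_⟩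
  obtain ⟨s, hs, z, hz, hsz⟩ := ht k hk
  obtain ⟨⟨s', m⟩, hm⟩ := IsLocalization.surj M s
  obtain ⟨m', hm'⟩ := multiple_mem_span_of_mem_localization_span M R _ _ hz
  have hs' : algebraMap D K s' = algebraMap R K s * algebraMap D K m := by
    rw [IsScalarTower.algebraMap_apply D R K, IsScalarTower.algebraMap_apply D R K, ← map_mul]
    exact congrArg _ hm.symm
  refine ⟨m' * s', ?_, (m : D) • (m' • z), Submodule.smul_mem _ _ hm', ?_⟩
  · rw [map_mul, map_mul, hs', map_mul, hM, hM, hs]; simp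
  · have : algebraMap D K (m' * s') * k - (m : D) • (m' • z) =
        algebraMap D K m * (algebraMap D K m' * (algebraMap R K s * k - z)) := by
      rw [map_mul, hs', Submonoid.smul_def, Algebra.smul_def, Algebra.smul_def]
      ring
    rw [this, map_mul, map_mul, hM, hM]
    simpa using hsz

theorem exists_finite_isGoodValuation_atPrime (K : Type*) [Field K] [Algebra D K]
    [IsFractionRing D K] {p : Ideal D} [hp : p.IsPrime] {x : D} (hxp : x ∈ p) (hx0 : x ≠ 0) :
    ∃ F : Set (Valuation K ℤᵐ⁰), F.Finite ∧
      (∀ v ∈ F, IsGoodValuation D v ∧ v (algebraMap D K x) < 1) ∧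
      ∀ b : K, (∀ a ∈ p, IsIntegral D (algebraMap D K a * b)) →
        (∀ v ∈ F, v b ≤ 1) → ∃ s ∉ p, IsIntegral D (algebraMap D K s * b) := by
  let R := Localization.subalgebra.ofField K p.primeCompl p.primeCompl_le_nonZeroDivisors
  have hloc : IsLocalization.AtPrime R p := Localization.subalgebra.isLocalization_ofField K _ _
  have hR : IsNoetherianRing R := IsLocalization.isNoetherianRing p.primeCompl R inferInstance
  have hRl : IsLocalRing R := IsLocalization.AtPrime.isLocalRing R p
  have hmem : algebraMap D R x ∈ IsLocalRing.maximalIdeal R :=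
    (IsLocalization.AtPrime.to_map_mem_maximal_iff R p x).2 hxp
  obtain ⟨F, hF, hFv, h⟩ := IsLocalRing.exists_finite_isGoodValuation K hmem
    ((map_ne_zero_iff _ (FaithfulSMul.algebraMap_injective D R)).2 hx0)
  refine ⟨F, hF, fun v hv => ⟨(hFv v hv).1.of_isLocalization p.primeCompl, (hFv v hv).2 _ hmem⟩, ?_⟩
  intro b hb hvb
  have hInt : IsIntegral R b := by
    refine h b (fun a ha => ?_) hvb
    obtain ⟨⟨a', m⟩, hm⟩ := IsLocalization.surj p.primeCompl a
    have ha' : a' ∈ p := by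
      rw [← IsLocalization.AtPrime.to_map_mem_maximal_iff R p a', ← hm]
      exact Ideal.mul_mem_right _ _ ha
    obtain ⟨u, hu⟩ := (IsLocalization.map_units R m).exists_right_inv
    have : a = algebraMap D R a' * u := by rw [← hm, mul_assoc, hu, mul_one]
    have h2 : algebraMap R K a * b = algebraMap R K u * (algebraMap D K a' * b) := by
      rw [this, map_mul, ← IsScalarTower.algebraMap_apply D R K]
      ring
    rw [h2]
    exact isIntegral_algebraMap.mul (hb a' ha').tower_top
  obtain ⟨s, hs⟩ := IsIntegral.exists_multiple_integral_of_isLocalization p.primeCompl b hInt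
  refine ⟨s.1, s.2, ?_⟩
  rwa [Submonoid.smul_def, Algebra.smul_def] at hs

theorem exists_finite_isGoodValuation (K : Type*) [Field K] [Algebra D K]
    [IsFractionRing D K] {x : D} (hx0 : x ≠ 0) :
    ∃ F : Set (Valuation K ℤᵐ⁰), F.Finite ∧
      (∀ v ∈ F, IsGoodValuation D v ∧ v (algebraMap D K x) < 1) ∧
      ∀ b : K, IsIntegral D (algebraMap D K x * b) → (∀ v ∈ F, v b ≤ 1) → IsIntegral D b := by
  have hex : ∀ p : Ideal D, ∃ F : Set (Valuation K ℤᵐ⁰), F.Finite ∧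
      (∀ v ∈ F, IsGoodValuation D v ∧ v (algebraMap D K x) < 1) ∧
      (p.IsPrime → x ∈ p → ∀ b : K, (∀ a ∈ p, IsIntegral D (algebraMap D K a * b)) →
        (∀ v ∈ F, v b ≤ 1) → ∃ s ∉ p, IsIntegral D (algebraMap D K s * b)) := by
    intro p
    by_cases h : p.IsPrime ∧ x ∈ p
    · obtain ⟨hp, hxp⟩ := h
      obtain ⟨F, h1, h2, h3⟩ := exists_finite_isGoodValuation_atPrime K hxp hx0
      exact ⟨F, h1, h2, fun _ _ => h3⟩
    · exact ⟨∅, Set.finite_empty, by simp, fun h1 h2 => absurd ⟨h1, h2⟩ h⟩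
  choose F hF1 hF2 hF3 using hex
  refine ⟨⋃ p ∈ associatedPrimes D (D ⧸ Ideal.span {x}), F p,
    (associatedPrimes.finite _ _).biUnion fun p _ => hF1 p, ?_, fun b hb hvb => ?_⟩
  · intro v hv
    simp only [Set.mem_iUnion] at hv
    obtain ⟨p, _, hv⟩ := hv
    exact hF2 p v hv
  by_contra hnb
  let B := Subalgebra.toSubmodule (integralClosure D K)
  let N := Submodule.span D {B.mkQ b}
  have hb0 : (⟨B.mkQ b, Submodule.mem_span_singleton_self _⟩ : N) ≠ 0 := by
    intro h
    have := congrArg Subtype.val h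
    exact hnb ((Submodule.Quotient.mk_eq_zero B).1 this)
  obtain ⟨p, hp, -⟩ := exists_le_isAssociatedPrime_of_isNoetherianRing D _ hb0
  rw [isAssociatedPrime_iff] at hp
  obtain ⟨hpp, ⟨z, hz⟩, hpz⟩ := hp
  obtain ⟨c, rfl⟩ := Submodule.mem_span_singleton.1 hz
  have hmem : ∀ a : D, a ∈ p ↔ IsIntegral D (algebraMap D K a * (algebraMap D K c * b)) := by
    intro a
    rw [hpz, Submodule.mem_colon_singleton, Submodule.mem_bot, Subtype.ext_iff]
    change a • c • B.mkQ b = 0 ↔ _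
    rw [← map_smul, ← map_smul, Submodule.mkQ_apply, Submodule.Quotient.mk_eq_zero,
      Algebra.smul_def, Algebra.smul_def]
    exact Iff.rfl
  have hxp : x ∈ p := by
    rw [hmem, mul_left_comm]
    exact isIntegral_algebraMap.mul hb
  have hpass := mem_associatedPrimes_of_not_isIntegral hxp hx0 (fun a ha => (hmem a).1 ha)
    (fun s hs => mt (hmem s).2 hs)
  obtain ⟨s, hsp, hs⟩ := hF3 p hpp hxp (algebraMap D K c * b) (fun a ha => (hmem a).1 ha)
    (fun v hv => by
      rw [map_mul]
      exact mul_le_one' ((hF2 p v hv).1.1 c) (hvb v (Set.mem_biUnion hpass hv)))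
  exact hsp ((hmem s).2 hs)

end GlobalCriterion

section FiniteQuotient

open scoped WithZero

/-- `A` is finitely generated modulo `A'`. -/
def Submodule.FGModulo {D M : Type*} [CommRing D] [AddCommGroup M] [Module D M]
    (A A' : Submodule D M) : Prop :=
  ∃ N : Submodule D M, N.FG ∧ N ≤ A ∧ A ≤ N ⊔ A'

namespace Submodule.FGModulo

variable {D M : Type*} [CommRing D] [AddCommGroup M] [Module D M]

theorem of_le {A A' : Submodule D M} (h : A ≤ A') : FGModulo A A' :=
  ⟨⊥, fg_bot, bot_le, h.trans le_sup_right⟩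

theorem trans {A B C : Submodule D M} (hBA : B ≤ A) (h1 : FGModulo A B) (h2 : FGModulo B C) :
    FGModulo A C := by
  obtain ⟨N1, hN1, hle1, h1⟩ := h1
  obtain ⟨N2, hN2, hle2, h2⟩ := h2
  refine ⟨N1 ⊔ N2, hN1.sup hN2, sup_le hle1 (hle2.trans hBA), h1.trans ?_⟩
  rw [sup_assoc]
  exact sup_le_sup_left h2 _

theorem of_fg_range {M' : Type*} [AddCommGroup M'] [Module D M'] {A A' : Submodule D M}
    (g : A →ₗ[D] M') (hg : (LinearMap.range g).FG) (h : ∀ z, g z = 0 → (z : M) ∈ A') :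
    FGModulo A A' := by
  classical
  obtain ⟨t, ht⟩ := hg
  have htA : (t : Set M') ⊆ g '' Set.univ := by
    rw [Set.image_univ, ← LinearMap.coe_range, ← ht]
    exact subset_span
  obtain ⟨s, -, rfl⟩ := Finset.subset_set_image_iff.1 htA
  refine ⟨(span D (s : Set A)).map A.subtype, (fg_span s.finite_toSet).map _,
    map_subtype_le A _, fun z hz => ?_⟩
  have hz' : g ⟨z, hz⟩ ∈ LinearMap.range g := ⟨_, rfl⟩
  rw [← ht, Finset.coe_image, ← Submodule.map_span] at hz'
  obtain ⟨n, hn, hnz⟩ := hz'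
  refine mem_sup.2 ⟨n, ⟨n, hn, rfl⟩, z - n, h (⟨z, hz⟩ - n) ?_, by abel⟩
  rw [map_sub, hnz, sub_self]

theorem of_linearMap {M' : Type*} [AddCommGroup M'] [Module D M'] [IsNoetherianRing D]
    {A A' : Submodule D M} {C C' : Submodule D M'} (f : M →ₗ[D] M') (hC : FGModulo C C')
    (h1 : ∀ z ∈ A, f z ∈ C) (h2 : ∀ z ∈ A, f z ∈ C' → z ∈ A') : FGModulo A A' := by
  obtain ⟨N, hN, _, hle⟩ := hC
  have hfin : Module.Finite D (N.map C'.mkQ) := Module.Finite.iff_fg.2 (hN.map _)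
  have hN' : IsNoetherian D (N.map C'.mkQ) := isNoetherian_of_isNoetherianRing_of_finite D _
  refine of_fg_range (C'.mkQ ∘ₗ f ∘ₗ A.subtype) ((isNoetherian_submodule.1 hN') _ ?_)
    fun z hz => h2 z z.2 ((Submodule.Quotient.mk_eq_zero C').1 hz)
  rintro _ ⟨z, rfl⟩
  obtain ⟨n, hn, c, hc, hnc⟩ := mem_sup.1 (hle (h1 z z.2))
  refine ⟨n, hn, ?_⟩
  have hc0 : C'.mkQ c = 0 := (Submodule.Quotient.mk_eq_zero C').2 hc
  rw [LinearMap.comp_apply, LinearMap.comp_apply, subtype_apply, ← hnc, map_add, hc0, add_zero]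

theorem mono_left [IsNoetherianRing D] {A C A' : Submodule D M} (hCA : C ≤ A)
    (h : FGModulo A A') : FGModulo C A' :=
  h.of_linearMap LinearMap.id (fun _ hz => hCA hz) fun _ _ h => h

theorem mono_right {A A' C : Submodule D M} (hCA : A' ≤ C)
    (h : FGModulo A A') : FGModulo A C := by
  obtain ⟨N, hN, hle, h⟩ := h
  exact ⟨N, hN, hle, h.trans (sup_le_sup_left hCA _)⟩

end Submodule.FGModulo

open Submodule

variable {D : Type*} [CommRing D]

/-- Elements of value at most `g`, for a valuation at most `1` on `D`. -/
def valuationBall {K : Type*} [Field K] [Algebra D K] (v : Valuation K ℤᵐ⁰)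
    (hv : ∀ d : D, v (algebraMap D K d) ≤ 1) (g : ℤᵐ⁰) : Submodule D K where
  carrier := {z | v z ≤ g}
  zero_mem' := by simp
  add_mem' := fun ha hb => v.map_add_le ha hb
  smul_mem' := fun r k hk => by
    rw [Set.mem_ofPred_eq, Algebra.smul_def, map_mul]
    exact (mul_le_mul' (hv r) hk).trans_eq (one_mul g)

theorem mem_valuationBall {K : Type*} [Field K] [Algebra D K] {v : Valuation K ℤᵐ⁰}
    {hv : ∀ d : D, v (algebraMap D K d) ≤ 1} {g : ℤᵐ⁰} {z : K} :
    z ∈ valuationBall v hv g ↔ v z ≤ g := Iff.rfl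

theorem WithZero.exists_eq_exp_neg_one_pow {g : ℤᵐ⁰} (h0 : g ≠ 0) (h1 : g ≤ 1) :
    ∃ n : ℕ, g = exp (-1 : ℤ) ^ n := by
  refine ⟨(-log g).toNat, ?_⟩
  have h : log g ≤ 0 := by rwa [log_le_iff_le_exp h0, exp_zero]
  rw [← exp_nsmul]
  conv_lhs => rw [← exp_log h0]
  congr 1
  rw [nsmul_eq_mul]
  lia

theorem WithZero.lt_exp_neg_one_pow_iff {g : ℤᵐ⁰} {n : ℕ} :
    g < exp (-1 : ℤ) ^ n ↔ g ≤ exp (-1 : ℤ) ^ (n + 1) := by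
  rcases eq_or_ne g 0 with rfl | h0
  · simp [zero_lt_iff]
  rw [← exp_nsmul, ← exp_nsmul, ← log_lt_iff_lt_exp h0, ← log_le_iff_le_exp h0, nsmul_eq_mul,
    nsmul_eq_mul]
  push_cast
  lia

theorem WithZero.exists_forall_pow_mul_le_one {ι : Type*} {F : Set ι} (hF : F.Finite)
    (f g : ι → ℤᵐ⁰) (hf : ∀ i ∈ F, f i < 1) : ∃ N : ℕ, ∀ i ∈ F, f i ^ N * g i ≤ 1 := by
  have h1 : ∀ i ∈ F, ∃ N : ℕ, f i ^ N * g i ≤ 1 := by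
    intro i hi
    rcases eq_or_ne (g i) 0 with h0 | h0
    · exact ⟨0, by simp [h0]⟩
    by_contra! hcon
    rcases eq_or_ne (f i) 0 with hf0 | hf0
    · have := hcon 1
      simp [hf0] at this
    refine WithZero.not_forall_mul_pow_le_one (inv_ne_zero h0)
      ((one_lt_inv₀ (zero_lt_iff.2 hf0)).2 (hf i hi)) fun n => ?_
    rw [inv_pow, ← mul_inv, mul_comm]
    exact inv_le_one_of_one_le₀ (hcon n).le
  choose! N hN using h1
  refine ⟨∑ i ∈ hF.toFinset, N i, fun i hi => le_trans ?_ (hN i hi)⟩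
  gcongr ?_ * _
  exact pow_le_pow_right_of_le_one' (hf i hi).le
    (Finset.single_le_sum (f := N) (fun _ _ => Nat.zero_le _) (hF.mem_toFinset.2 hi))

variable {K : Type*} [Field K] [Algebra D K]

/-- A finite set of good valuations, positive at `x`, detecting integrality of elements with
denominator `x`. -/
structure IsDetecting (x : D) (F : Set (Valuation K ℤᵐ⁰)) : Prop where
  finite : F.Finite
  good : ∀ v ∈ F, IsGoodValuation D v ∧ v (algebraMap D K x) < 1
  isIntegral : ∀ b : K, IsIntegral D (algebraMap D K x * b) → (∀ v ∈ F, v b ≤ 1) → IsIntegral D b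

theorem IsDetecting.isIntegral_of_pow {x : D} {F : Set (Valuation K ℤᵐ⁰)} (hF : IsDetecting x F)
    (n : ℕ) {b : K} (hb : IsIntegral D (algebraMap D K x ^ n * b)) (hv : ∀ v ∈ F, v b ≤ 1) :
    IsIntegral D b := by
  induction n with
  | zero => simpa using hb
  | succ n ih =>
    refine ih (hF.isIntegral _ ?_ fun v hvF => ?_)
    · rwa [← mul_assoc, ← pow_succ']
    · rw [map_mul, map_pow]
      exact mul_le_one' (pow_le_one' ((hF.good v hvF).1.1 x) n) (hv v hvF)

theorem exists_minimal_isDetecting [IsDomain D] [IsNoetherianRing D] (K : Type*)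
    [Field K] [Algebra D K] [IsFractionRing D K] {x : D}
    (hx0 : x ≠ 0) : ∃ F : Set (Valuation K ℤᵐ⁰), IsDetecting x F ∧
      ∀ v ∈ F, ¬ IsDetecting x (F \ {v}) := by
  obtain ⟨F0, h1, h2, h3⟩ := exists_finite_isGoodValuation K hx0
  obtain ⟨F, hF, hmin⟩ := (measure Set.ncard).wf.has_min
    {F : Set (Valuation K ℤᵐ⁰) | IsDetecting x F}
    ⟨F0, h1, h2, h3⟩
  refine ⟨F, hF, fun v hv hd => hmin _ hd ?_⟩
  exact Set.ncard_sdiff_singleton_lt_of_mem hv hF.finite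

theorem IsDetecting.exists_separating [IsFractionRing D K] {x : D} (hx0 : x ≠ 0)
    {F : Set (Valuation K ℤᵐ⁰)}
    (hF : IsDetecting x F) {v : Valuation K ℤᵐ⁰} (hv : v ∈ F) (hmin : ¬ IsDetecting x (F \ {v})) :
    ∃ s : K, IsIntegral D s ∧ v s = 1 ∧ ∀ w ∈ F, w ≠ v → w s < 1 := by
  have hex : ∃ b : K, IsIntegral D (algebraMap D K x * b) ∧ (∀ w ∈ F \ {v}, w b ≤ 1) ∧
      ¬ IsIntegral D b := by
    by_contra! hcon
    exact hmin ⟨hF.finite.subset Set.sdiff_subset, fun w hw => hF.good w hw.1, hcon⟩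
  obtain ⟨b, hxb, hwb, hnb⟩ := hex
  have hvb : 1 < v b := by
    by_contra! hle
    refine hnb (hF.isIntegral b hxb fun w hw => ?_)
    by_cases hwv : w = v
    · rwa [hwv]
    · exact hwb w ⟨hw, hwv⟩
  have hxK : algebraMap D K x ≠ 0 := (map_ne_zero_iff _ (IsFractionRing.injective D K)).2 hx0
  obtain ⟨e, he⟩ := WithZero.exists_eq_exp_neg_one_pow ((v.ne_zero_iff).2 hxK)
    ((hF.good v hv).1.1 x)
  have hvb0 : v b ≠ 0 := (zero_lt_one.trans hvb).ne'
  obtain ⟨β, hβ⟩ := WithZero.exists_eq_exp_neg_one_pow (inv_ne_zero hvb0)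
    (inv_le_one_of_one_le₀ hvb.le)
  have hβ0 : β ≠ 0 := by
    rintro rfl
    rw [pow_zero, inv_eq_one] at hβ
    exact hvb.ne' hβ
  have hvs : v (b ^ e * algebraMap D K x ^ β) = 1 := by
    rw [map_mul, map_pow, map_pow, he, ← pow_mul, mul_comm e β, pow_mul, ← hβ, inv_pow,
      mul_inv_cancel₀ (pow_ne_zero e hvb0)]
  have hws : ∀ w ∈ F, w ≠ v → w (b ^ e * algebraMap D K x ^ β) < 1 := by
    intro w hw hne
    rw [map_mul, map_pow, map_pow]
    calc w b ^ e * w (algebraMap D K x) ^ β ≤ 1 * w (algebraMap D K x) ^ β := by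
          gcongr; exact pow_le_one' (hwb w ⟨hw, hne⟩) e
      _ < 1 := by rw [one_mul]; exact pow_lt_one₀ zero_le (hF.good w hw).2 hβ0
  refine ⟨_, hF.isIntegral_of_pow e ?_ fun w hw => ?_, hvs, hws⟩
  · have : algebraMap D K x ^ e * (b ^ e * algebraMap D K x ^ β) =
        (algebraMap D K x * b) ^ e * algebraMap D K (x ^ β) := by rw [map_pow, mul_pow]; ring
    rw [this]
    exact (hxb.pow e).mul isIntegral_algebraMap
  · by_cases hwv : w = v
    · rw [hwv, hvs]
    · exact (hws w hw hwv).le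

variable [IsNoetherianRing D]

variable (D K) in
/-- The integral closure as a submodule. -/
abbrev closureModule : Submodule D K := Subalgebra.toSubmodule (integralClosure D K)

theorem IsDetecting.fgModulo_ball_succ [IsFractionRing D K] {x : D} (hx0 : x ≠ 0)
    {F : Set (Valuation K ℤᵐ⁰)}
    (hF : IsDetecting x F) {v : Valuation K ℤᵐ⁰} (hv : v ∈ F) (hmin : ¬ IsDetecting x (F \ {v}))
    (hgood : ∀ d : D, v (algebraMap D K d) ≤ 1)
    (hfg : FGModulo (closureModule D K) (valuationBall v hgood (WithZero.exp (-1 : ℤ)))) (n : ℕ) :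
    FGModulo (closureModule D K ⊓ valuationBall v hgood (WithZero.exp (-1 : ℤ) ^ n))
      (closureModule D K ⊓ valuationBall v hgood (WithZero.exp (-1 : ℤ) ^ (n + 1))) := by
  by_cases hex : ∃ z : K, IsIntegral D z ∧ v z = WithZero.exp (-1 : ℤ) ^ n
  swap
  · refine FGModulo.of_le fun z hz => ⟨hz.1, ?_⟩
    rw [SetLike.mem_coe, mem_valuationBall, ← WithZero.lt_exp_neg_one_pow_iff]
    exact lt_of_le_of_ne hz.2 fun h => hex ⟨z, hz.1, h⟩
  obtain ⟨z0, hz0, hvz0⟩ := hex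
  obtain ⟨s, hs, hvs, hws⟩ := hF.exists_separating hx0 hv hmin
  have hxK : algebraMap D K x ≠ 0 := (map_ne_zero_iff _ (IsFractionRing.injective D K)).2 hx0
  obtain ⟨e, he⟩ := WithZero.exists_eq_exp_neg_one_pow ((v.ne_zero_iff).2 hxK) (hgood x)
  have he0 : e ≠ 0 := by
    rintro rfl
    exact (hF.good v hv).2.ne (by rw [he, pow_zero])
  obtain ⟨e', rfl⟩ := Nat.exists_eq_succ_of_ne_zero he0
  let β : K := z0 ^ e' * (algebraMap D K x ^ n)⁻¹
  have hπ : (WithZero.exp (-1 : ℤ)) ≠ 0 := WithZero.exp_ne_zero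
  have hvβ : v β * WithZero.exp (-1 : ℤ) ^ n = 1 := by
    simp only [β, map_mul, map_inv₀, map_pow, hvz0, he]
    generalize WithZero.exp (-1 : ℤ) = q at hπ
    rw [← pow_mul, ← pow_mul, mul_right_comm, ← pow_add, show n * e' + n = (e' + 1) * n by ring]
    exact mul_inv_cancel₀ (pow_ne_zero _ hπ)
  obtain ⟨N, hN⟩ := WithZero.exists_forall_pow_mul_le_one (F := F \ {v})
    (hF.finite.subset Set.sdiff_subset) (fun w => w s) (fun w => w β) fun w hw => hws w hw.1 hw.2
  have hvc : v (s ^ N * β) * WithZero.exp (-1 : ℤ) ^ n = 1 := by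
    rw [map_mul, map_pow, hvs, one_pow, one_mul, hvβ]
  refine hfg.of_linearMap (LinearMap.mulLeft D (s ^ N * β)) (fun z hz => ?_) (fun z hz hz' => ?_)
  · change IsIntegral D (s ^ N * β * z)
    refine hF.isIntegral_of_pow n ?_ fun w hw => ?_
    · have : algebraMap D K x ^ n * (s ^ N * β * z) = s ^ N * z0 ^ e' * z := by
        simp only [β]
        field_simp
      rw [this]
      exact ((hs.pow N).mul (hz0.pow e')).mul hz.1
    · by_cases hwv : w = v
      · rw [hwv, ← hvc, map_mul]
        gcongr
        exact hz.2
      · rw [map_mul, map_mul, map_pow]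
        exact mul_le_one' (hN w ⟨hw, hwv⟩) (w.le_one_of_isIntegral (hF.good w hw).1.1 hz.1)
  · refine ⟨hz.1, ?_⟩
    rw [mem_valuationBall, LinearMap.mulLeft_apply, map_mul] at hz'
    rw [SetLike.mem_coe, mem_valuationBall]
    calc v z = (v (s ^ N * β) * WithZero.exp (-1 : ℤ) ^ n) * v z := by rw [hvc, one_mul]
      _ = (v (s ^ N * β) * v z) * WithZero.exp (-1 : ℤ) ^ n := mul_right_comm _ _ _
      _ ≤ WithZero.exp (-1 : ℤ) * WithZero.exp (-1 : ℤ) ^ n := by gcongr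
      _ = _ := (pow_succ' _ n).symm

theorem fgModulo_mul_closureModule [IsDomain D] [IsFractionRing D K] {x : D} (hx0 : x ≠ 0)
    (h : ∀ v : Valuation K ℤᵐ⁰, ∀ hv : IsGoodValuation D v, v (algebraMap D K x) < 1 →
      FGModulo (closureModule D K) (valuationBall v hv.1 (WithZero.exp (-1 : ℤ)))) :
    FGModulo (closureModule D K)
      ((closureModule D K).map (LinearMap.mulLeft D (algebraMap D K x))) := by
  obtain ⟨F, hF, hmin⟩ := exists_minimal_isDetecting K hx0
  have hxK : algebraMap D K x ≠ 0 := (map_ne_zero_iff _ (IsFractionRing.injective D K)).2 hx0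
  have hball : ∀ v (hv : v ∈ F), FGModulo (closureModule D K)
      (valuationBall v (hF.good v hv).1.1 (v (algebraMap D K x))) := by
    intro v hv
    have hv1 : ∀ d : D, v (algebraMap D K d) ≤ 1 := (hF.good v hv).1.1
    obtain ⟨e, he⟩ := WithZero.exists_eq_exp_neg_one_pow ((v.ne_zero_iff).2 hxK) (hv1 x)
    have key : ∀ n : ℕ, FGModulo (closureModule D K) (closureModule D K ⊓
        valuationBall v hv1 (WithZero.exp (-1 : ℤ) ^ n)) := by
      intro n
      induction n with
      | zero =>
        refine FGModulo.of_le fun z hz => ⟨hz, ?_⟩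
        rw [SetLike.mem_coe, mem_valuationBall, pow_zero]
        exact v.le_one_of_isIntegral hv1 hz
      | succ n ih =>
        exact ih.trans inf_le_left (hF.fgModulo_ball_succ hx0 hv (hmin v hv) _
          (h v (hF.good v hv).1 (hF.good v hv).2) n)
    have hle : closureModule D K ⊓ valuationBall v hv1 (WithZero.exp (-1 : ℤ) ^ e) ≤
        valuationBall v hv1 (v (algebraMap D K x)) := fun z hz => hz.2.trans_eq he.symm
    exact (key e).mono_right hle
  let C : Set (Valuation K ℤᵐ⁰) → Submodule D K := fun E =>
    ⨅ v : {v : F // v.1 ∈ E}, valuationBall v.1.1 (hF.good v.1.1 v.1.2).1.1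
      (v.1.1 (algebraMap D K x))
  have hC : ∀ E : Set (Valuation K ℤᵐ⁰), E.Finite → E ⊆ F →
      FGModulo (closureModule D K) (closureModule D K ⊓ C E) := by
    intro E hE
    induction E, hE using Set.Finite.induction_on with
    | empty =>
      refine fun _ => FGModulo.of_le (le_inf le_rfl (le_iInf fun v => absurd v.2 (by simp)))
    | @insert v E _ _ ih =>
      intro hsub
      have hv : v ∈ F := hsub (Set.mem_insert v E)
      refine (ih fun w hw => hsub (Set.mem_insert_of_mem v hw)).trans inf_le_left ?_
      refine ((hball v hv).mono_left inf_le_left).of_linearMap (A := closureModule D K ⊓ C E)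
        LinearMap.id (fun z hz => hz) fun z hz hz' => ⟨hz.1, ?_⟩
      refine (Submodule.mem_iInf _).2 ?_
      rintro ⟨⟨w, hwF⟩, hw⟩
      rcases Set.mem_insert_iff.1 hw with hw | hw
      · have hwv : w = v := hw
        subst hwv
        exact hz'
      · exact (Submodule.mem_iInf _).1 hz.2 ⟨⟨w, hwF⟩, hw⟩
  refine (hC F hF.finite subset_rfl).mono_right ?_
  rintro z ⟨hz, hzC⟩
  refine ⟨(algebraMap D K x)⁻¹ * z, hF.isIntegral _ ?_ fun v hv => ?_, ?_⟩
  · rw [mul_inv_cancel_left₀ hxK]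
    exact hz
  · have h1 : v z ≤ v (algebraMap D K x) := (Submodule.mem_iInf _).1 hzC ⟨⟨v, hv⟩, hv⟩
    rw [map_mul, map_inv₀]
    exact inv_mul_le_one_of_le₀ h1 zero_le
  · rw [LinearMap.mulLeft_apply, mul_inv_cancel_left₀ hxK]

end FiniteQuotient

section CompleteNakayama

open scoped WithZero
open Submodule

theorem IsAdicComplete.exists_seq_eq_add_mul {G : Type*} [CommRing G] (I : Ideal G)
    [IsAdicComplete I G] {x : G} (hx : x ∈ I) (g : ℕ → G) :
    ∃ h : ℕ → G, ∀ J, h J = g J + x * h (J + 1) := by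
  have hsm : ∀ (n : ℕ) (a b : G), a ≡ b [SMOD (I ^ n • ⊤ : Submodule G G)] ↔ a - b ∈ I ^ n := by
    intro n a b
    rw [SModEq.sub_mem, smul_eq_mul, Ideal.mul_top]
  let S : ℕ → ℕ → G := fun J n => ∑ j ∈ Finset.range n, x ^ j * g (J + j)
  have hlim : ∀ J, ∃ L : G, ∀ n, S J n - L ∈ I ^ n := by
    intro J
    obtain ⟨L, hL⟩ := IsPrecomplete.prec (I := I) (M := G) inferInstance (f := S J) fun {m n} hmn => by
      rw [hsm, ← neg_mem_iff, neg_sub]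
      change ∑ j ∈ Finset.range n, _ - ∑ j ∈ Finset.range m, _ ∈ _
      rw [← Finset.sum_range_add_sum_Ico _ hmn, add_sub_cancel_left]
      refine sum_mem fun j hj => Ideal.mul_mem_right _ _ ?_
      exact Ideal.pow_le_pow_right (Finset.mem_Ico.1 hj).1 (Ideal.pow_mem_pow hx j)
    exact ⟨L, fun n => (hsm _ _ _).1 (hL n)⟩
  choose h hh using hlim
  refine ⟨h, fun J => ?_⟩
  rw [← sub_eq_zero]
  refine IsHausdorff.haus (I := I) inferInstance _ fun n => ?_
  rw [hsm, sub_zero]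
  have hS : S J (n + 1) = g J + x * S (J + 1) n := by
    simp only [S, Finset.sum_range_succ', Finset.mul_sum]
    rw [add_comm]
    congr 1
    · simp
    · refine Finset.sum_congr rfl fun j _ => ?_
      rw [pow_succ', mul_assoc, add_right_comm, add_assoc]
  have h1 : S J (n + 1) - h J ∈ I ^ n := Ideal.pow_le_pow_right n.le_succ (hh J (n + 1))
  have h2 := Ideal.mul_mem_left _ x (hh (J + 1) n)
  have h3 : h J - (g J + x * h (J + 1)) =
      x * (S (J + 1) n - h (J + 1)) - (S J (n + 1) - h J) := by rw [hS]; ring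
  rw [h3]
  exact sub_mem h2 h1

theorem not_isIntegral_inv_of_mem_jacobson {G K : Type*} [CommRing G] [Field K] [Algebra G K]
    {x : G}
    (hx : x ∈ Ideal.jacobson (⊥ : Ideal G)) (hx0 : algebraMap G K x ≠ 0) :
    ¬ IsIntegral G (algebraMap G K x)⁻¹ := by
  intro hInt
  obtain ⟨m, hm⟩ := Ideal.exists_maximal (integralClosure G K)
  have hcm := Ideal.isMaximal_comap_of_isIntegral_of_isMaximal (R := G) m
  have h1 : x ∈ m.comap (algebraMap G (integralClosure G K)) :=
    Ideal.mem_sInf.1 hx ⟨bot_le, hcm⟩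
  refine hm.ne_top ((Ideal.eq_top_iff_one m).2 ?_)
  have h2 := Ideal.mul_mem_left m (⟨_, hInt⟩ : integralClosure G K) (Ideal.mem_comap.1 h1)
  convert h2 using 1
  exact Subtype.ext (inv_mul_cancel₀ hx0).symm

theorem exists_fg_of_fgModulo_mul {G D K : Type*} [CommRing G] [CommRing D] [IsDomain D]
    [Algebra G D] [Module.Finite G D] [IsNoetherianRing G] [Field K] [Algebra D K]
    [IsFractionRing D K] [Algebra G K] [IsScalarTower G D K] (I : Ideal G) [IsAdicComplete I G]
    {x : G} (hxI : x ∈ I) (hx0 : algebraMap G D x ≠ 0)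
    (hfg : FGModulo (closureModule D K) ((closureModule D K).map
      (LinearMap.mulLeft D (algebraMap D K (algebraMap G D x))))) :
    ∃ N : Submodule G K, N.FG ∧ ∀ b, IsIntegral D b → b ∈ N := by
  have hD : IsNoetherianRing D := isNoetherian_of_tower G
    (isNoetherian_of_isNoetherianRing_of_finite G D)
  obtain ⟨F, hF, -⟩ := exists_minimal_isDetecting K hx0
  have hxK : algebraMap G K x ≠ 0 := by
    rw [IsScalarTower.algebraMap_apply G D K]
    exact (map_ne_zero_iff _ (IsFractionRing.injective D K)).2 hx0
  have hne : F.Nonempty := by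
    by_contra hemp
    rw [Set.not_nonempty_iff_eq_empty] at hemp
    refine not_isIntegral_inv_of_mem_jacobson (IsAdicComplete.le_jacobson_bot I hxI) hxK ?_
    refine isIntegral_trans (A := D) _ (hF.isIntegral _ ?_ (by simp [hemp]))
    rw [← IsScalarTower.algebraMap_apply, mul_inv_cancel₀ hxK]
    exact isIntegral_one
  obtain ⟨v, hv⟩ := hne
  obtain ⟨N, hN, hNle, hle⟩ := hfg
  have hNG : (N.restrictScalars G).FG := hN.restrictScalars
  refine ⟨N.restrictScalars G, hNG, fun b hb => ?_⟩
  obtain ⟨r, c, hc⟩ := Submodule.fg_iff_exists_fin_generating_family.1 hNG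
  have hcB : ∀ i, IsIntegral D (c i) := fun i => hNle (by
    have : c i ∈ N.restrictScalars G := hc ▸ subset_span ⟨i, rfl⟩
    exact this)
  have hstep : ∀ β : closureModule D K, ∃ (g : Fin r → G) (β' : closureModule D K),
      (β : K) = ∑ i, g i • c i + algebraMap G K x * β' := by
    intro β
    obtain ⟨n, hn, _, ⟨β', hβ', rfl⟩, hβ⟩ := mem_sup.1 (hle β.2)
    have hn' : n ∈ N.restrictScalars G := hn
    rw [← hc, mem_span_range_iff_exists_fun] at hn'
    obtain ⟨g, hg⟩ := hn'
    refine ⟨g, ⟨β', hβ'⟩, ?_⟩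
    rw [← hβ, hg, LinearMap.mulLeft_apply, ← IsScalarTower.algebraMap_apply]
  choose g nxt hnxt using hstep
  let β : ℕ → closureModule D K := fun J => nxt^[J] ⟨b, hb⟩
  have hβ : ∀ J, β (J + 1) = nxt (β J) := fun J => Function.iterate_succ_apply' _ _ _
  have hlim : ∀ i, ∃ h : ℕ → G, ∀ J, h J = g (β J) i + x * h (J + 1) := fun i =>
    IsAdicComplete.exists_seq_eq_add_mul I hxI _
  choose h hh using hlim
  let δ : ℕ → K := fun J => (β J : K) - ∑ i, h i J • c i
  have hδ : ∀ J, δ J = algebraMap G K x * δ (J + 1) := by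
    intro J
    simp only [δ]
    rw [hnxt (β J), ← hβ, mul_sub, Finset.mul_sum]
    have : ∀ i, h i J • c i = g (β J) i • c i + algebraMap G K x * (h i (J + 1) • c i) := by
      intro i
      rw [hh i J, add_smul, mul_smul, Algebra.smul_def x]
    simp only [this, Finset.sum_add_distrib]
    ring
  have hδpow : ∀ J, δ 0 = algebraMap G K x ^ J * δ J := by
    intro J
    induction J with
    | zero => simp
    | succ J ih => rw [ih, hδ J]; ring
  have hδv : ∀ J, v (δ J) ≤ 1 := by
    intro J
    refine v.le_one_of_isIntegral (hF.good v hv).1.1 ?_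
    refine IsIntegral.sub (β J).2 (IsIntegral.sum _ fun i _ => ?_)
    rw [Algebra.smul_def, IsScalarTower.algebraMap_apply G D K]
    exact isIntegral_algebraMap.mul (hcB i)
  have hδ0 : δ 0 = 0 := by
    by_contra hne0
    have hvx0 : v (algebraMap G K x) ≠ 0 := v.ne_zero_iff.2 hxK
    have hvx1 : v (algebraMap G K x) < 1 := by
      rw [IsScalarTower.algebraMap_apply G D K]
      exact (hF.good v hv).2
    refine WithZero.not_forall_mul_pow_le_one (v.ne_zero_iff.2 hne0)
      ((one_lt_inv₀ (zero_lt_iff.2 hvx0)).2 hvx1) fun n => ?_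
    rw [hδpow n, map_mul, map_pow, mul_right_comm, ← mul_pow, mul_inv_cancel₀ hvx0, one_pow,
      one_mul]
    exact hδv n
  have hb' : b = ∑ i, h i 0 • c i := sub_eq_zero.1 hδ0
  rw [hb', ← hc]
  exact sum_mem fun i _ => smul_mem _ _ (subset_span ⟨i, rfl⟩)

end CompleteNakayama

section FiniteIntegralExtensions

open scoped WithZero
open Submodule

/-- `E` is birational to a finitely generated `G`-subalgebra. -/
def Algebra.IsGenericallyFG (G E : Type*) [CommRing G] [CommRing E] [Algebra G E] : Prop :=
  ∃ T : Finset E, ∀ e : E, ∃ s ∈ Algebra.adjoin G (T : Set E), s ≠ 0 ∧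
    s * e ∈ Algebra.adjoin G (T : Set E)

/-- Integral generically finite domain extensions of quotients of `G` are finite. This is the
Nagata property of `G`. -/
def IsNagataRing.{v, w} (G : Type v) [CommRing G] : Prop :=
  ∀ (E : Type w) [CommRing E] [IsDomain E] [Algebra G E], Algebra.IsIntegral G E →
    Algebra.IsGenericallyFG G E → Module.Finite G E

theorem Algebra.adjoin_le_adjoin_of_tower {G D E : Type*} [CommRing G] [CommRing D] [CommRing E]
    [Algebra G D] [Algebra D E] [Algebra G E] [IsScalarTower G D E] {T : Set E} {z : E}
    (hz : z ∈ Algebra.adjoin G T) : z ∈ Algebra.adjoin D T :=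
  (Algebra.adjoin_le (S := (Algebra.adjoin D T).restrictScalars G) Algebra.subset_adjoin) hz

theorem Algebra.IsGenericallyFG.tower_top {G D E : Type*} [CommRing G] [CommRing D] [CommRing E]
    [Algebra G D] [Algebra D E] [Algebra G E] [IsScalarTower G D E]
    (h : Algebra.IsGenericallyFG G E) : Algebra.IsGenericallyFG D E := by
  obtain ⟨T, hT⟩ := h
  refine ⟨T, fun e => ?_⟩
  obtain ⟨s, hs, hs0, hse⟩ := hT e
  exact ⟨s, adjoin_le_adjoin_of_tower hs, hs0, adjoin_le_adjoin_of_tower hse⟩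

theorem Algebra.IsGenericallyFG.trans {G D E : Type*} [CommRing G] [CommRing D] [CommRing E]
    [Algebra G D] [Algebra D E] [Algebra G E] [IsScalarTower G D E] [hD : Algebra.FiniteType G D]
    (h : Algebra.IsGenericallyFG D E) : Algebra.IsGenericallyFG G E := by
  classical
  obtain ⟨T, hT⟩ := h
  obtain ⟨T₀, hT₀⟩ := hD.out
  set U : Finset E := T ∪ T₀.image (algebraMap D E) with hU
  have hmap : ∀ d : D, algebraMap D E d ∈ Algebra.adjoin G (U : Set E) := by
    intro d
    have hd : d ∈ Algebra.adjoin G (T₀ : Set D) := hT₀ ▸ Algebra.mem_top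
    have h1 : Algebra.adjoin G (T₀ : Set D) ≤
        (Algebra.adjoin G (U : Set E)).comap (IsScalarTower.toAlgHom G D E) := by
      refine Algebra.adjoin_le fun y hy => Algebra.subset_adjoin ?_
      simp only [hU, Finset.coe_union, Finset.coe_image]
      exact Or.inr ⟨y, hy, rfl⟩
    exact h1 hd
  have hle : ∀ z ∈ Algebra.adjoin D (T : Set E), z ∈ Algebra.adjoin G (U : Set E) := by
    intro z hz
    induction hz using Algebra.adjoin_induction with
    | mem y hy => exact Algebra.subset_adjoin (by simp [hU, Finset.mem_coe.1 hy])
    | algebraMap d => exact hmap d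
    | add y z _ _ hy hz => exact add_mem hy hz
    | mul y z _ _ hy hz => exact mul_mem hy hz
  refine ⟨U, fun e => ?_⟩
  obtain ⟨s, hs, hs0, hse⟩ := hT e
  exact ⟨s, hle _ hs, hs0, hle _ hse⟩

theorem Module.Finite.of_algebraMap_surjective {G G' : Type*} [CommRing G] [CommRing G']
    [Algebra G G'] (h : Function.Surjective (algebraMap G G')) : Module.Finite G G' :=
  Module.Finite.of_surjective (Algebra.linearMap G G') h

theorem IsNagataRing.finite_of_surjective.{v, v', w} {G : Type v} {G' : Type v'} {E : Type w}
    [CommRing G] [CommRing G'] [CommRing E] [IsDomain E] [Algebra G G'] [Algebra G' E]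
    [Algebra G E] [IsScalarTower G G' E] (h : IsNagataRing.{v', w} G')
    (hsurj : Function.Surjective (algebraMap G G')) (hInt : Algebra.IsIntegral G E)
    (hE : Algebra.IsGenericallyFG G E) : Module.Finite G E := by
  have h1 := Module.Finite.of_algebraMap_surjective hsurj
  have h2 : Module.Finite G' E := h E (Algebra.IsIntegral.tower_top (R := G)) hE.tower_top
  exact Module.Finite.trans G' E

theorem IsNagataRing.of_surjective.{v, v', w} {G : Type v} {G' : Type v'}
    [CommRing G] [CommRing G'] (h : IsNagataRing.{v, w} G) (f : G →+* G')
    (hf : Function.Surjective f) : IsNagataRing.{v', w} G' := by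
  intro E _ _ _ hInt hE
  let _ := f.toAlgebra
  let _ := Algebra.compHom E f
  have htow : IsScalarTower G G' E := IsScalarTower.of_algebraMap_eq fun _ => rfl
  have h1 : Module.Finite G G' := Module.Finite.of_algebraMap_surjective hf
  have h2 : Module.Finite G E := h E (Algebra.IsIntegral.trans G') hE.trans
  exact Module.Finite.of_restrictScalars_finite G G' E

/-- The ideal of integral elements of positive valuation. -/
def valuationCenter {D K : Type*} [CommRing D] [Field K] [Algebra D K] (v : Valuation K ℤᵐ⁰)
    (hv : ∀ d, v (algebraMap D K d) ≤ 1) : Ideal (integralClosure D K) where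
  carrier := {b | v b < 1}
  zero_mem' := by simp
  add_mem' := fun ha hb => v.map_add_lt ha hb
  smul_mem' := fun c b hb => by
    change v ((c : K) * b) < 1
    rw [map_mul]
    exact (mul_le_of_le_one_left' (v.le_one_of_isIntegral hv c.2)).trans_lt hb

theorem mem_valuationCenter {D K : Type*} [CommRing D] [Field K] [Algebra D K]
    {v : Valuation K ℤᵐ⁰} {hv : ∀ d, v (algebraMap D K d) ≤ 1} {b : integralClosure D K} :
    b ∈ valuationCenter v hv ↔ v (b : K) < 1 := Iff.rfl

theorem isPrime_valuationCenter {D K : Type*} [CommRing D] [Field K] [Algebra D K]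
    (v : Valuation K ℤᵐ⁰) (hv : ∀ d, v (algebraMap D K d) ≤ 1) :
    (valuationCenter v hv).IsPrime where
  ne_top' := by
    rw [Ideal.ne_top_iff_one, mem_valuationCenter]
    simp
  mem_or_mem' := by
    intro b c hbc
    rw [mem_valuationCenter] at *
    rw [mem_valuationCenter]
    by_contra! hcon
    have hb : v (b : K) = 1 := le_antisymm (v.le_one_of_isIntegral hv b.2) hcon.1
    have hc : v (c : K) = 1 := le_antisymm (v.le_one_of_isIntegral hv c.2) hcon.2
    rw [Subalgebra.coe_mul, map_mul, hb, hc, one_mul] at hbc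
    exact lt_irrefl _ hbc

theorem IsGoodValuation.isGenericallyFG {D K : Type*} [CommRing D]
    [IsNoetherianRing D] [Field K] [Algebra D K]
    {v : Valuation K ℤᵐ⁰} (hv : IsGoodValuation D v) :
    Algebra.IsGenericallyFG D (integralClosure D K ⧸ valuationCenter v hv.1) := by
  classical
  obtain ⟨t, ht, hk⟩ := hv.2
  set ball := valuationBall v hv.1 (WithZero.exp (-1 : ℤ)) with hballdef
  have hball : ∀ z : K, z ∈ ball ↔ v z < 1 := fun z => by
    rw [mem_valuationBall]
    simpa using (WithZero.lt_exp_neg_one_pow_iff (g := v z) (n := 0)).symm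
  have hfg : FGModulo (closureModule D K ⊓ (span D (t : Set K) ⊔ ball)) ball :=
    FGModulo.mono_left inf_le_right ⟨span D (t : Set K), ⟨t, rfl⟩, le_sup_left, le_rfl⟩
  obtain ⟨N, ⟨u, hu⟩, hNle, hle⟩ := hfg
  have huB : ∀ z ∈ u, z ∈ integralClosure D K := fun z hz =>
    (hNle (hu ▸ subset_span hz)).1
  let T : Finset (integralClosure D K ⧸ valuationCenter v hv.1) :=
    (Finset.attach u).image fun z : {z // z ∈ u} => Ideal.Quotient.mk _ ⟨z, huB z z.2⟩
  have hNT : ∀ (n : K) (hn : n ∈ N), Ideal.Quotient.mk (valuationCenter v hv.1)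
      ⟨n, (hNle hn).1⟩ ∈ Algebra.adjoin D (T : Set (integralClosure D K ⧸ _)) := by
    intro n hn
    have h1 : N ≤ ((Subalgebra.toSubmodule
        (Algebra.adjoin D (T : Set (integralClosure D K ⧸ valuationCenter v hv.1)))).comap
        (Ideal.Quotient.mkₐ D (valuationCenter v hv.1)).toLinearMap).map
        (integralClosure D K).val.toLinearMap := by
      rw [← hu, span_le]
      intro z hz
      exact ⟨⟨z, huB z hz⟩, Algebra.subset_adjoin (Finset.mem_coe.2 (Finset.mem_image.2
        ⟨⟨z, hz⟩, Finset.mem_attach _ _, rfl⟩)), rfl⟩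
    obtain ⟨z, hz, rfl⟩ := h1 hn
    exact hz
  refine ⟨T, fun e => ?_⟩
  obtain ⟨k, rfl⟩ := Ideal.Quotient.mk_surjective e
  obtain ⟨s, hs, z, hz, hsz⟩ := hk k (v.le_one_of_isIntegral hv.1 k.2)
  have hsk : algebraMap D K s * k ∈ closureModule D K :=
    (integralClosure D K).mul_mem ((integralClosure D K).algebraMap_mem s) k.2
  have hsk2 : algebraMap D K s * k ∈ span D (t : Set K) ⊔ ball :=
    mem_sup.2 ⟨z, hz, _, (hball _).2 hsz, by ring⟩
  obtain ⟨n, hn, m, hm, hnm⟩ := mem_sup.1 (hle (mem_inf.2 ⟨hsk, hsk2⟩))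
  refine ⟨algebraMap D _ s, algebraMap_mem _ s, fun h0 => ?_, ?_⟩
  · have h1 : algebraMap D (integralClosure D K) s ∈ valuationCenter v hv.1 :=
      Ideal.Quotient.eq_zero_iff_mem.1 h0
    rw [mem_valuationCenter] at h1
    exact h1.ne hs
  · convert hNT n hn using 1
    refine Ideal.Quotient.eq.2 ?_
    rw [mem_valuationCenter]
    change v (algebraMap D K s * k - n) < 1
    rw [← hnm, add_sub_cancel_left]
    exact (hball m).1 hm

theorem IsGoodValuation.fgModulo_of_finite {D K : Type*} [CommRing D] [IsNoetherianRing D]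
    [Field K] [Algebra D K] {v : Valuation K ℤᵐ⁰} (hv : IsGoodValuation D v)
    (h : Module.Finite D (integralClosure D K ⧸ valuationCenter v hv.1)) :
    FGModulo (closureModule D K) (valuationBall v hv.1 (WithZero.exp (-1 : ℤ))) := by
  let g : closureModule D K →ₗ[D] (integralClosure D K ⧸ valuationCenter v hv.1) :=
    (Ideal.Quotient.mkₐ D (valuationCenter v hv.1)).toLinearMap
  refine FGModulo.of_fg_range g (IsNoetherian.noetherian _) fun z hz => ?_
  have h1 : (⟨z, z.2⟩ : integralClosure D K) ∈ valuationCenter v hv.1 :=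
    Ideal.Quotient.eq_zero_iff_mem.1 hz
  rw [mem_valuationCenter] at h1
  rw [mem_valuationBall]
  have h2 := (WithZero.lt_exp_neg_one_pow_iff (n := 0)).1 (by simpa using h1)
  simpa using h2

/-- A Noetherian ring that is adically complete is Nagata as soon as its quotient is. -/
theorem IsNagataRing.of_isAdicComplete.{v, w} {G : Type v} [CommRing G] [IsNoetherianRing G]
    (I : Ideal G) [IsAdicComplete I G] (hI : IsNagataRing.{v, w} (G ⧸ I)) :
    IsNagataRing.{v, w} G := by
  suffices H : ∀ (P : Ideal G) (E : Type w) [CommRing E] [IsDomain E] [Algebra G E],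
      RingHom.ker (algebraMap G E) = P → Algebra.IsIntegral G E →
      Algebra.IsGenericallyFG G E → Module.Finite G E from
    fun E _ _ _ hInt hE => H _ E rfl hInt hE
  intro P
  induction P using WellFoundedGT.induction with
  | ind P IH =>
  intro E _ _ _ hker hInt hE
  by_cases hIP : I ≤ P
  · let f : G ⧸ I →+* E := Ideal.Quotient.lift I (algebraMap G E) fun z hz => by
      rw [← RingHom.mem_ker, hker]; exact hIP hz
    let _ := f.toAlgebra
    have htow : IsScalarTower G (G ⧸ I) E := IsScalarTower.of_algebraMap_eq fun _ => rfl
    exact hI.finite_of_surjective Ideal.Quotient.mk_surjective hInt hE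
  obtain ⟨x, hxI, hxP⟩ := SetLike.not_le_iff_exists.1 hIP
  obtain ⟨T, hT⟩ := hE
  let D := Algebra.adjoin G (T : Set E)
  let K := FractionRing E
  have hDfin : Module.Finite G D := Algebra.finite_adjoin_of_finite_of_isIntegral T.finite_toSet
    fun z _ => Algebra.IsIntegral.isIntegral z
  have hDK : IsFractionRing D K := by
    refine IsFractionRing.of_field D K fun z => ?_
    obtain ⟨e₁, e₂, he₂, rfl⟩ := IsFractionRing.div_surjective (A := E) z
    obtain ⟨s₁, hs₁, hs₁0, h₁⟩ := hT e₁
    obtain ⟨s₂, hs₂, hs₂0, h₂⟩ := hT e₂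
    refine ⟨⟨s₁ * e₁, h₁⟩ * ⟨s₂, hs₂⟩, ⟨s₁, hs₁⟩ * ⟨s₂ * e₂, h₂⟩, ?_⟩
    have hinj : ∀ e : E, e ≠ 0 → algebraMap E K e ≠ 0 := fun e he =>
      (map_ne_zero_iff _ (IsFractionRing.injective E K)).2 he
    have ha := hinj _ hs₁0
    have hb := hinj _ hs₂0
    have hc := hinj _ (nonZeroDivisors.ne_zero he₂)
    have hd : ∀ d : D, algebraMap D K d = algebraMap E K d := fun d => rfl
    rw [hd, hd]
    simp only [MulMemClass.coe_mul, map_mul]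
    rw [div_eq_div_iff hc (mul_ne_zero ha (mul_ne_zero hb hc))]
    ring
  have hDN : IsNoetherianRing D :=
    isNoetherian_of_tower G (isNoetherian_of_isNoetherianRing_of_finite G D)
  have hx0 : algebraMap G D x ≠ 0 := by
    intro h0
    apply hxP
    rw [← hker, RingHom.mem_ker, IsScalarTower.algebraMap_apply G D E, h0, map_zero]
  obtain ⟨N, hN, hle⟩ := exists_fg_of_fgModulo_mul (G := G) (D := D) (K := K) I hxI hx0 (by
    refine fgModulo_mul_closureModule hx0 fun v hv hvx => hv.fgModulo_of_finite ?_
    have hprime := isPrime_valuationCenter v hv.1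
    have hkerle : P < RingHom.ker
        (algebraMap G (integralClosure D K ⧸ valuationCenter v hv.1)) := by
      have hK : ∀ g : G, ((algebraMap G (integralClosure D K) g : integralClosure D K) : K) =
          algebraMap E K (algebraMap G E g) := fun g => rfl
      refine SetLike.lt_iff_le_and_exists.2 ⟨fun g hg => ?_, x, ?_, hxP⟩
      · rw [← hker, RingHom.mem_ker] at hg
        refine Ideal.Quotient.eq_zero_iff_mem.2 ?_
        rw [mem_valuationCenter, hK, hg, map_zero, map_zero]
        exact zero_lt_one
      · refine Ideal.Quotient.eq_zero_iff_mem.2 ?_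
        exact hvx
    have hint1 : Algebra.IsIntegral D (integralClosure D K ⧸ valuationCenter v hv.1) :=
      Algebra.IsIntegral.of_surjective (Ideal.Quotient.mkₐ D (valuationCenter v hv.1))
        Ideal.Quotient.mk_surjective
    have hfin := IH _ hkerle (integralClosure D K ⧸ valuationCenter v hv.1) rfl
      (Algebra.IsIntegral.trans D) hv.isGenericallyFG.trans
    exact Module.Finite.of_restrictScalars_finite G D _)
  have hNN : IsNoetherian G N := isNoetherian_of_fg_of_noetherian N hN
  have hEN : ∀ e : E, algebraMap E K e ∈ N := fun e =>
    hle _ ((Algebra.IsIntegral.isIntegral (R := G) e).tower_top.map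
      (IsScalarTower.toAlgHom D E K))
  refine Module.Finite.of_injective
    ((IsScalarTower.toAlgHom G E K).toLinearMap.codRestrict N hEN) fun y z hyz => ?_
  exact IsFractionRing.injective E K (congrArg Subtype.val hyz)

end FiniteIntegralExtensions

section NagataRings

theorem IsNagataRing.of_field.{v, w} (F : Type v) [Field F] : IsNagataRing.{v, w} F := by
  intro E _ _ _ hInt ⟨T, hT⟩
  have hfin : Module.Finite F (Algebra.adjoin F (T : Set E)) :=
    Algebra.finite_adjoin_of_finite_of_isIntegral T.finite_toSet
      fun z _ => Algebra.IsIntegral.isIntegral z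
  have hfield : IsField (Algebra.adjoin F (T : Set E)) :=
    isField_of_isIntegral_of_isField' (Field.toIsField F)
  have htop : Algebra.adjoin F (T : Set E) = ⊤ := by
    refine eq_top_iff.2 fun e _ => ?_
    obtain ⟨s, hs, hs0, hse⟩ := hT e
    obtain ⟨⟨r, hr⟩, hsr⟩ := hfield.mul_inv_cancel (a := ⟨s, hs⟩)
      fun h => hs0 (congrArg Subtype.val h)
    have h1 : s * r = 1 := congrArg Subtype.val hsr
    have h2 : e = r * (s * e) := by rw [← mul_assoc, mul_comm r, h1, one_mul]
    rw [h2]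
    exact mul_mem hr hse
  rw [htop] at hfin
  exact Module.Finite.of_surjective (⊤ : Subalgebra F E).val.toLinearMap
    fun e => ⟨⟨e, trivial⟩, rfl⟩

theorem Module.Finite.int_of_isGenericallyFG {E : Type*} (K : Type*) [CommRing E] [IsDomain E]
    [CharZero E] [Field K] [Algebra E K] [IsFractionRing E K] (hInt : Algebra.IsIntegral ℤ E)
    (hE : Algebra.IsGenericallyFG ℤ E) : Module.Finite ℤ E := by
  obtain ⟨T, hT⟩ := hE
  have hK : CharZero K := IsFractionRing.charZero_of_isFractionRing E
  let L := IntermediateField.adjoin ℚ (algebraMap E K '' (T : Set E))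
  have hL : FiniteDimensional ℚ L := by
    refine IntermediateField.finiteDimensional_adjoin ?_
    rintro _ ⟨e, -, rfl⟩
    exact ((hInt.isIntegral e).map (algebraMap E K).toIntAlgHom).tower_top
  have hTL : ∀ d ∈ Algebra.adjoin ℤ (T : Set E), algebraMap E K d ∈ L := by
    intro d hd
    induction hd using Algebra.adjoin_induction with
    | mem y hy => exact IntermediateField.subset_adjoin _ _ ⟨y, hy, rfl⟩
    | algebraMap n => simp
    | add y z _ _ hy hz => rw [map_add]; exact add_mem hy hz
    | mul y z _ _ hy hz => rw [map_mul]; exact mul_mem hy hz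
  have hEL : ∀ e : E, algebraMap E K e ∈ L := by
    intro e
    obtain ⟨s, hs, hs0, hse⟩ := hT e
    have h0 : algebraMap E K s ≠ 0 := (map_ne_zero_iff _ (IsFractionRing.injective E K)).2 hs0
    have h1 : algebraMap E K e = (algebraMap E K s)⁻¹ * algebraMap E K (s * e) := by
      rw [map_mul, inv_mul_cancel_left₀ h0]
    rw [h1]
    exact mul_mem (inv_mem (hTL s hs)) (hTL _ hse)
  have hnf : NumberField L := ⟨⟩
  let f : E →+* L := (algebraMap E K).codRestrict L.toSubring hEL
  have hf : Function.Injective f := fun y z h =>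
    IsFractionRing.injective E K (congrArg Subtype.val h)
  let g : E →+* NumberField.RingOfIntegers L :=
    f.codRestrict (integralClosure ℤ L) fun e => (hInt.isIntegral e).map f.toIntAlgHom
  exact Module.Finite.of_injective g.toIntAlgHom.toLinearMap
    fun y z h => hf (congrArg Subtype.val h)

theorem IsNagataRing.int.{w} : IsNagataRing.{0, w} ℤ := by
  intro E _ _ alg hInt hE
  obtain rfl : alg = Ring.toIntAlgebra E := Subsingleton.elim _ _
  obtain ⟨p, hp⟩ := CharP.exists E
  rcases CharP.char_is_prime_or_zero E p with hprime | rfl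
  · have _ : Fact p.Prime := ⟨hprime⟩
    let _ := ZMod.algebra E p
    exact (IsNagataRing.of_field (ZMod p)).finite_of_surjective (ZMod.intCast_surjective) hInt hE
  have hchar := CharP.charP_to_charZero E
  exact Module.Finite.int_of_isGenericallyFG (FractionRing E) hInt hE

theorem IsNagataRing.powerSeries.{v, w} {G : Type v} [CommRing G] [IsNoetherianRing G]
    (h : IsNagataRing.{v, w} G) : IsNagataRing.{v, w} (PowerSeries G) := by
  refine .of_isAdicComplete (Ideal.span {PowerSeries.X})
    (h.of_surjective ((Ideal.Quotient.mk _).comp PowerSeries.C) fun z => ?_)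
  obtain ⟨f, rfl⟩ := Ideal.Quotient.mk_surjective z
  refine ⟨PowerSeries.constantCoeff f, ?_⟩
  rw [RingHom.comp_apply, Ideal.Quotient.eq, Ideal.mem_span_singleton, PowerSeries.X_dvd_iff]
  simp

theorem IsNagataRing.mvPowerSeries.{v, w} {G : Type v} [CommRing G] [IsNoetherianRing G]
    (h : IsNagataRing.{v, w} G) (n : ℕ) : IsNagataRing.{v, w} (MvPowerSeries (Fin n) G) := by
  induction n with
  | zero =>
    exact h.of_surjective (MvPowerSeries.isEmptyEquiv (Fin 0) G).symm.toRingEquiv.toRingHom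
      (MvPowerSeries.isEmptyEquiv (Fin 0) G).symm.surjective
  | succ n ih =>
    exact ih.powerSeries.of_surjective (MvPowerSeries.finSuccEquiv G n).symm.toRingEquiv.toRingHom
      (MvPowerSeries.finSuccEquiv G n).symm.surjective

end NagataRings

section FiniteClosure

theorem RingHom.exists_range_C_mul_X_pow {W D : Type*} [CommRing W] [CommRing D] [Algebra W D]
    [hD : Algebra.FiniteType W D] : ∃ (n : ℕ) (φ : MvPowerSeries (Fin n) W →+* PowerSeries D),
      PowerSeries.X ∈ φ.range ∧
        ∀ d : D, ∃ N : ℕ, PowerSeries.C d * PowerSeries.X ^ N ∈ φ.range := by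
  obtain ⟨T, hT⟩ := hD.out
  let r : Fin (T.card + 1) → D := Fin.cons 1 fun i => (T.equivFin.symm i : D)
  have hsub : MvPowerSeries.HasSubst
      (fun i => PowerSeries.C (r i) * PowerSeries.X : Fin (T.card + 1) → PowerSeries D) := by
    refine MvPowerSeries.hasSubst_of_constantCoeff_zero fun i => ?_
    exact (PowerSeries.X_dvd_iff.1 (dvd_mul_left _ _) :
      PowerSeries.constantCoeff (PowerSeries.C (r i) * PowerSeries.X) = 0)
  let φ : MvPowerSeries (Fin (T.card + 1)) W →ₐ[W] PowerSeries D :=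
    MvPowerSeries.substAlgHom hsub
  have hφX : ∀ i, φ (MvPowerSeries.X i) = PowerSeries.C (r i) * PowerSeries.X :=
    MvPowerSeries.substAlgHom_X hsub
  have hX : PowerSeries.X ∈ φ.toRingHom.range := ⟨MvPowerSeries.X 0, by
    change φ _ = _
    rw [hφX]
    simp [r]⟩
  refine ⟨_, φ.toRingHom, hX, fun d => ?_⟩
  have hd : d ∈ Algebra.adjoin W (T : Set D) := hT ▸ Algebra.mem_top
  induction hd using Algebra.adjoin_induction with
  | mem y hy =>
    refine ⟨1, MvPowerSeries.X (T.equivFin ⟨y, hy⟩).succ, ?_⟩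
    change φ _ = _
    rw [hφX]
    simp [r]
  | algebraMap w =>
    refine ⟨0, algebraMap W _ w, ?_⟩
    change φ _ = _
    rw [φ.commutes, pow_zero, mul_one, PowerSeries.algebraMap_apply]
  | add y z _ _ hy hz =>
    obtain ⟨m, hm⟩ := hy
    obtain ⟨n, hn⟩ := hz
    refine ⟨m + n, ?_⟩
    have h1 := add_mem (mul_mem hm (pow_mem hX n)) (mul_mem hn (pow_mem hX m))
    convert h1 using 1
    rw [map_add]
    ring
  | mul y z _ _ hy hz =>
    obtain ⟨m, hm⟩ := hy
    obtain ⟨n, hn⟩ := hz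
    refine ⟨m + n, ?_⟩
    convert mul_mem hm hn using 1
    rw [map_mul]
    ring

/-- Finiteness of the integral closure of a domain dominated, after adjoining a power series
variable, by a Nagata ring. -/
theorem IsNagataRing.finite_integralClosure_of_range.{v, w} {G : Type v} {D : Type w} (K : Type w)
    [CommRing G] [IsNoetherianRing G] [CommRing D] [IsDomain D] [IsNoetherianRing D] [Field K]
    [Algebra D K] [IsFractionRing D K] (hG : IsNagataRing.{v, w} G) (φ : G →+* PowerSeries D)
    (hX : PowerSeries.X ∈ φ.range)
    (hφ : ∀ d : D, ∃ N : ℕ, PowerSeries.C d * PowerSeries.X ^ N ∈ φ.range) :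
    Module.Finite D (integralClosure D K) := by
  classical
  have hφ' : ∀ d : D, ∃ N : ℕ, ∀ M, N ≤ M → PowerSeries.C d * PowerSeries.X ^ M ∈ φ.range := by
    intro d
    obtain ⟨N, hN⟩ := hφ d
    refine ⟨N, fun M hM => ?_⟩
    rw [← Nat.add_sub_of_le hM, pow_add, ← mul_assoc]
    exact mul_mem hN (pow_mem hX _)
  let θ : PowerSeries D →+* PowerSeries K := PowerSeries.map (algebraMap D K)
  let _ : Algebra G (PowerSeries K) := (θ.comp φ).toAlgebra
  have hθ : ∀ z ∈ φ.range, ∃ g : G, algebraMap G (PowerSeries K) g = θ z := by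
    rintro _ ⟨g, rfl⟩
    exact ⟨g, rfl⟩
  let H : Set (PowerSeries K) :=
    {f | IsIntegral G f ∧ ∃ (β : K) (n : ℕ), f = PowerSeries.C β * PowerSeries.X ^ n}
  have hclosure : ∀ β : K, IsIntegral D β →
      ∃ n : ℕ, PowerSeries.C β * PowerSeries.X ^ n ∈ H := by
    rintro β ⟨p, hp, hpβ⟩
    choose N' hN' using hφ'
    let N := (Finset.range p.natDegree).sup fun i => N' (p.coeff i)
    have hlift : (p.map PowerSeries.C).scaleRoots (PowerSeries.X ^ N) ∈ Polynomial.lifts φ := by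
      rw [Polynomial.lifts_iff_coeff_lifts]
      intro i
      rw [Polynomial.coeff_scaleRoots, Polynomial.coeff_map, hp.natDegree_map, ← pow_mul]
      rcases lt_trichotomy i p.natDegree with hi | rfl | hi
      · refine hN' (p.coeff i) _ ?_
        exact (Finset.le_sup (f := fun i => N' (p.coeff i)) (Finset.mem_range.2 hi)).trans
          (Nat.le_mul_of_pos_right N (Nat.sub_pos_of_lt hi))
      · exact ⟨1, by simp [hp.coeff_natDegree]⟩
      · exact ⟨0, by simp [Polynomial.coeff_eq_zero_of_natDegree_lt hi]⟩
    obtain ⟨q, hq, -, hqm⟩ := Polynomial.lifts_and_natDegree_eq_and_monic hlift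
      ((Polynomial.monic_scaleRoots_iff _).2 (hp.map _))
    refine ⟨N, ⟨q, hqm, ?_⟩, β, N, rfl⟩
    have h1 : Polynomial.eval₂ θ (PowerSeries.C β) (p.map PowerSeries.C) = 0 := by
      have hcomp : θ.comp PowerSeries.C = PowerSeries.C.comp (algebraMap D K) :=
        RingHom.ext fun d => PowerSeries.map_C _ d
      rw [Polynomial.eval₂_map, hcomp, ← Polynomial.hom_eval₂, hpβ, map_zero]
    have h2 := Polynomial.scaleRoots_eval₂_eq_zero (s := PowerSeries.X ^ N) θ h1
    rw [← hq, Polynomial.eval₂_map, map_pow, PowerSeries.map_X, mul_comm] at h2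
    exact h2
  let E := Algebra.adjoin G H
  have hEint : Algebra.IsIntegral G E := by
    refine ⟨fun e => ?_⟩
    have hle : E ≤ integralClosure G (PowerSeries K) := Algebra.adjoin_le fun f hf => hf.1
    exact (isIntegral_algHom_iff E.val Subtype.val_injective).1 (hle e.2)
  have hEgen : Algebra.IsGenericallyFG G E := by
    have hE : ∀ e ∈ E, ∃ g : G, algebraMap G (PowerSeries K) g ≠ 0 ∧
        ∃ g' : G, algebraMap G (PowerSeries K) g' = algebraMap G (PowerSeries K) g * e := by
      intro e he
      induction he using Algebra.adjoin_induction with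
      | mem y hy =>
        obtain ⟨-, β, n, rfl⟩ := hy
        obtain ⟨a, b, hb, rfl⟩ := IsFractionRing.div_surjective (A := D) β
        have hb0 : algebraMap D K b ≠ 0 :=
          (map_ne_zero_iff _ (IsFractionRing.injective D K)).2 (nonZeroDivisors.ne_zero hb)
        obtain ⟨Na, ha⟩ := hφ' a
        obtain ⟨Nb, hb⟩ := hφ' b
        obtain ⟨g, hg⟩ := hθ _ (hb (Na + Nb) le_add_self)
        obtain ⟨g', hg'⟩ := hθ _ (ha (Na + Nb + n) (by omega))
        rw [map_mul, map_pow, PowerSeries.map_X, PowerSeries.map_C] at hg hg'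
        refine ⟨g, ?_, g', ?_⟩
        · rw [hg]
          exact mul_ne_zero ((map_ne_zero_iff _ PowerSeries.C_injective).2 hb0)
            (pow_ne_zero _ PowerSeries.X_ne_zero)
        · have h1 : algebraMap D K a =
              algebraMap D K b * (algebraMap D K a / algebraMap D K b) := by
            field_simp
          rw [hg, hg', h1, map_mul, ← h1, pow_add]
          ring
      | algebraMap g => exact ⟨1, by simp, g, by simp⟩
      | add y z _ _ hy hz =>
        obtain ⟨g, hg, g', hgg⟩ := hy
        obtain ⟨h, hh, h', hhh⟩ := hz
        refine ⟨g * h, by rw [map_mul]; exact mul_ne_zero hg hh, g' * h + g * h', ?_⟩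
        rw [map_add, map_mul, map_mul, map_mul, hgg, hhh]
        ring
      | mul y z _ _ hy hz =>
        obtain ⟨g, hg, g', hgg⟩ := hy
        obtain ⟨h, hh, h', hhh⟩ := hz
        refine ⟨g * h, by rw [map_mul]; exact mul_ne_zero hg hh, g' * h', ?_⟩
        rw [map_mul, map_mul, hgg, hhh]
        ring
    refine ⟨∅, fun e => ?_⟩
    obtain ⟨g, hg, g', hg'⟩ := hE e e.2
    refine ⟨algebraMap G E g, algebraMap_mem _ g, fun h => hg (congrArg Subtype.val h), ?_⟩
    have h1 : algebraMap G E g * e = algebraMap G E g' := Subtype.ext hg'.symm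
    rw [h1]
    exact algebraMap_mem _ g'
  have hEfin : Module.Finite G E := hG E hEint hEgen
  have hspan : (Submodule.span G H).FG := by
    have h1 : IsNoetherian G (Subalgebra.toSubmodule E) :=
      isNoetherian_of_isNoetherianRing_of_finite G E
    exact isNoetherian_submodule.1 h1 _ (Submodule.span_le.2 Algebra.subset_adjoin)
  obtain ⟨T, hTH, hT⟩ := Submodule.fg_span_iff_fg_span_finset_subset _ |>.1 hspan
  choose! β d hβ using fun f (hf : f ∈ H) => hf.2
  let M : Submodule D K := Submodule.span D (T.image β)
  have hM : ∀ f ∈ Submodule.span G H, ∀ n, PowerSeries.coeff n f ∈ M := by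
    intro f hf
    rw [hT] at hf
    induction hf using Submodule.span_induction with
    | zero => simp
    | mem y hy =>
      intro n
      rw [hβ y (hTH hy), PowerSeries.coeff_C_mul, PowerSeries.coeff_X_pow]
      split_ifs
      · rw [mul_one]
        exact Submodule.subset_span (Finset.mem_coe.2 (Finset.mem_image_of_mem _ hy))
      · simp
    | add y z _ _ hy hz => exact fun n => by rw [map_add]; exact add_mem (hy n) (hz n)
    | smul g y _ hy =>
      intro n
      rw [Algebra.smul_def, PowerSeries.coeff_mul]
      refine sum_mem fun ij _ => ?_
      have h1 : PowerSeries.coeff ij.1 (algebraMap G (PowerSeries K) g) =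
          algebraMap D K (PowerSeries.coeff ij.1 (φ g)) := PowerSeries.coeff_map _ _ _
      rw [h1, ← Algebra.smul_def]
      exact Submodule.smul_mem _ _ (hy _)
  have hMN : IsNoetherian D M := isNoetherian_of_fg_of_noetherian M ⟨_, rfl⟩
  have hle : Subalgebra.toSubmodule (integralClosure D K) ≤ M := by
    intro b hb
    obtain ⟨n, hn⟩ := hclosure b hb
    have h1 := hM _ (Submodule.subset_span hn) n
    rwa [PowerSeries.coeff_C_mul, PowerSeries.coeff_X_pow, if_pos rfl, mul_one] at h1
  exact Module.Finite.of_injective (Submodule.inclusion hle) (Submodule.inclusion_injective hle)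

theorem IsNagataRing.finite_integralClosure.{v, w} {W : Type v} {D : Type w} (K : Type w)
    [CommRing W] [IsNoetherianRing W] [CommRing D] [IsDomain D] [Algebra W D]
    [Algebra.FiniteType W D] [Field K] [Algebra D K] [IsFractionRing D K]
    (hW : IsNagataRing.{v, w} W) : Module.Finite D (integralClosure D K) := by
  have hDN : IsNoetherianRing D := Algebra.FiniteType.isNoetherianRing W D
  obtain ⟨n, φ, hX, hφ⟩ := RingHom.exists_range_C_mul_X_pow (W := W) (D := D)
  exact (hW.mvPowerSeries n).finite_integralClosure_of_range K φ hX hφ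

end FiniteClosure

section ReesClosure

theorem isIntegral_reesAlgebra_of_mem_intClosure {S : Type u} [CommRing S] {I : Ideal S} {n : ℕ}
    {x : S} (hx : x ∈ intClosure (I ^ n)) : IsIntegral (reesAlgebra I) (monomial n x) := by
  induction hx using Submodule.span_induction with
  | zero => rw [map_zero]; exact isIntegral_zero
  | add y z _ _ hy hz => rw [map_add]; exact hy.add hz
  | smul s y _ hy =>
    have h1 : monomial n (s • y) = algebraMap (reesAlgebra I) S[X] (algebraMap S _ s) *
        monomial n y := (C_mul_monomial ..).symm
    rw [h1]
    exact isIntegral_algebraMap.mul hy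
  | mem y hy =>
    obtain ⟨m, hm, c, hc, hyc⟩ := hy
    have hcm : ∀ i ∈ Finset.Icc 1 m, monomial (n * i) (c i) ∈ reesAlgebra I := fun i hi => by
      rw [reesAlgebra.monomial_mem, pow_mul]
      exact hc i (Finset.mem_Icc.1 hi).1 (Finset.mem_Icc.1 hi).2
    let q : (reesAlgebra I)[X] :=
      ∑ i ∈ (Finset.Icc 1 m).attach, C ⟨_, hcm i i.2⟩ * X ^ (m - i)
    have hq : q.degree < m := by
      refine (degree_sum_le _ _).trans_lt ((Finset.sup_lt_iff (WithBot.bot_lt_coe m)).2 ?_)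
      rintro ⟨i, hi⟩ -
      refine (degree_C_mul_X_pow_le _ _).trans_lt ?_
      have := Finset.mem_Icc.1 hi
      exact WithBot.coe_lt_coe.2 (show m - i < m by omega)
    refine ⟨X ^ m + q, monic_X_pow_add hq, ?_⟩
    have h1 : ∀ i ∈ Finset.Icc 1 m,
        monomial (n * i) (c i) * monomial n y ^ (m - i) = monomial (n * m) (c i * y ^ (m - i)) := by
      intro i hi
      have := Finset.mem_Icc.1 hi
      rw [monomial_pow, monomial_mul_monomial, ← mul_add, Nat.add_sub_of_le this.2]
    have h2 : eval₂ (algebraMap (reesAlgebra I) S[X]) (monomial n y) q =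
        ∑ i ∈ Finset.Icc 1 m, monomial (n * m) (c i * y ^ (m - i)) := by
      rw [← Finset.sum_congr rfl h1, ← Finset.sum_attach, eval₂_finsetSum]
      refine Finset.sum_congr rfl fun i _ => ?_
      rw [eval₂_mul, eval₂_C, eval₂_pow, eval₂_X]
      rfl
    rw [eval₂_add, eval₂_pow, eval₂_X, h2, monomial_pow, ← map_sum, ← map_add, hyc, map_zero]

theorem mem_intClosure_of_isIntegral_reesAlgebra {S : Type u} [CommRing S] {I : Ideal S} {n : ℕ}
    {x : S} (hx : IsIntegral (reesAlgebra I) (monomial n x)) : x ∈ intClosure (I ^ n) := by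
  nontriviality S
  obtain ⟨q, hq, hqx⟩ := hx
  have hm : 0 < q.natDegree := by
    rw [Nat.pos_iff_ne_zero]
    intro h0
    rw [hq.natDegree_eq_zero.1 h0, eval₂_one] at hqx
    exact one_ne_zero hqx
  refine Ideal.subset_span ⟨q.natDegree, hm,
    fun i => (q.coeff (q.natDegree - i) : S[X]).coeff (n * i), fun i _ _ => ?_, ?_⟩
  · rw [← pow_mul]
    exact (q.coeff (q.natDegree - i)).2 _
  · have h1 := congrArg (fun p : S[X] => p.coeff (n * q.natDegree)) hqx
    simp only [coeff_zero] at h1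
    rw [eval₂_eq_sum_range, Finset.sum_range_succ, hq.coeff_natDegree, map_one, one_mul,
      monomial_pow, coeff_add, coeff_monomial, if_pos rfl, finsetSum_coeff, add_comm] at h1
    rw [← h1]
    congr 1
    refine Finset.sum_bij' (fun i _ => q.natDegree - i) (fun j _ => q.natDegree - j) ?_ ?_ ?_ ?_ ?_
    · intro i hi
      have := Finset.mem_Icc.1 hi
      exact Finset.mem_range.2 (by omega)
    · intro j hj
      have := Finset.mem_range.1 hj
      exact Finset.mem_Icc.2 (by omega)
    · intro i hi
      have := Finset.mem_Icc.1 hi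
      omega
    · intro j hj
      have := Finset.mem_range.1 hj
      omega
    · intro i hi
      have := Finset.mem_Icc.1 hi
      have h2 : n * q.natDegree = n * i + n * (q.natDegree - i) := by
        rw [← mul_add, Nat.add_sub_of_le this.2]
      rw [monomial_pow, h2, coeff_mul_monomial]
      rfl

theorem mem_intClosure_of_pow_mem {S : Type u} [CommRing S] {I : Ideal S} {n t : ℕ} (ht : 0 < t)
    {x : S} (hx : x ^ t ∈ intClosure (I ^ (n * t))) : x ∈ intClosure (I ^ n) := by
  have h1 := isIntegral_reesAlgebra_of_mem_intClosure hx
  rw [← monomial_pow] at h1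
  exact mem_intClosure_of_isIntegral_reesAlgebra (h1.of_pow ht)

theorem le_intClosure {S : Type u} [CommRing S] (I : Ideal S) : I ≤ intClosure I := by
  intro x hx
  refine Ideal.subset_span ⟨1, one_pos, fun _ => -x, fun i hi hi' => ?_, by simp⟩
  rw [le_antisymm hi' hi, pow_one]
  exact neg_mem hx

theorem C_pow_natDegree_mul_mem_reesAlgebra {S : Type u} [CommRing S] {I : Ideal S} {f : S}
    (hf : f ∈ I) (p : S[X]) : C (f ^ p.natDegree) * p ∈ reesAlgebra I := by
  intro i
  rw [coeff_C_mul]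
  rcases le_or_gt i p.natDegree with hi | hi
  · exact Ideal.mul_mem_right _ _ (Ideal.pow_le_pow_right hi (Ideal.pow_mem_pow hf _))
  · rw [coeff_eq_zero_of_natDegree_lt hi, mul_zero]
    exact zero_mem _

theorem isFractionRing_reesAlgebra {S : Type u} (L : Type*) [CommRing S] [IsDomain S] {I : Ideal S}
    (hI : I ≠ ⊥) [Field L] [Algebra S[X] L] [IsFractionRing S[X] L] :
    IsFractionRing (reesAlgebra I) L := by
  obtain ⟨f, hf, hf0⟩ := Submodule.exists_mem_ne_zero_of_ne_bot hI
  have hinj := IsFractionRing.injective S[X] L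
  have hfs : FaithfulSMul (reesAlgebra I) L := (faithfulSMul_iff_algebraMap_injective _ _).2
    (hinj.comp Subtype.val_injective)
  refine IsFractionRing.of_field (reesAlgebra I) L fun z => ?_
  obtain ⟨p, q, hq, rfl⟩ := IsFractionRing.div_surjective (A := S[X]) z
  have hq0 : algebraMap S[X] L q ≠ 0 :=
    (map_ne_zero_iff _ hinj).2 (nonZeroDivisors.ne_zero hq)
  have hC : ∀ n, algebraMap S[X] L (C (f ^ n)) ≠ 0 := fun n =>
    (map_ne_zero_iff _ hinj).2 (C_ne_zero.2 (pow_ne_zero n hf0))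
  have hCm : ∀ n, C (f ^ n) ∈ reesAlgebra I := fun n => (reesAlgebra I).algebraMap_mem (f ^ n)
  refine ⟨⟨_, C_pow_natDegree_mul_mem_reesAlgebra hf p⟩ * ⟨_, hCm q.natDegree⟩,
    ⟨_, C_pow_natDegree_mul_mem_reesAlgebra hf q⟩ * ⟨_, hCm p.natDegree⟩, ?_⟩
  have hd : ∀ d : reesAlgebra I, algebraMap (reesAlgebra I) L d = algebraMap S[X] L d :=
    fun d => rfl
  rw [hd, hd]
  simp only [MulMemClass.coe_mul, map_mul]
  rw [div_eq_div_iff hq0 (mul_ne_zero (mul_ne_zero (hC _) hq0) (hC _))]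
  ring

theorem exists_intClosure_pow_le {S : Type u} (L : Type*) [CommRing S] [IsDomain S]
    [IsNoetherianRing S] {I : Ideal S} [Field L] [Algebra S[X] L] [IsFractionRing S[X] L]
    (h : Module.Finite (reesAlgebra I) (integralClosure (reesAlgebra I) L)) :
    ∃ k : ℕ, ∀ n, intClosure (I ^ (n + k)) ≤ I ^ n := by
  have hfin : Module.Finite (reesAlgebra I) (integralClosure (reesAlgebra I) S[X]) := by
    have hN : IsNoetherian (reesAlgebra I) (integralClosure (reesAlgebra I) L) :=
      isNoetherian_of_isNoetherianRing_of_finite (reesAlgebra I)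
        (integralClosure (reesAlgebra I) L)
    let g := (IsScalarTower.toAlgHom (reesAlgebra I) S[X] L).mapIntegralClosure
    refine Module.Finite.of_injective g.toLinearMap fun y z hyz => Subtype.ext ?_
    exact IsFractionRing.injective S[X] L (congrArg Subtype.val hyz)
  obtain ⟨T, hT⟩ := (Module.Finite.iff_fg (N := Subalgebra.toSubmodule
    (integralClosure (reesAlgebra I) S[X]))).1 hfin
  refine ⟨T.sup natDegree, fun n x hx => ?_⟩
  have hcoeff : ∀ p ∈ Submodule.span (reesAlgebra I) (T : Set S[X]),
      ∀ m, p.coeff m ∈ I ^ (m - T.sup natDegree) := by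
    intro p hp
    induction hp using Submodule.span_induction with
    | zero => simp
    | add y z _ _ hy hz => exact fun m => by rw [coeff_add]; exact add_mem (hy m) (hz m)
    | mem y hy =>
      intro m
      rcases le_or_gt m (T.sup natDegree) with hm | hm
      · simp [Nat.sub_eq_zero_of_le hm]
      · rw [coeff_eq_zero_of_natDegree_lt ((Finset.le_sup hy).trans_lt hm)]
        exact zero_mem _
    | smul d y _ hy =>
      intro m
      rw [Algebra.smul_def, coeff_mul]
      refine sum_mem fun ij hij => ?_
      have := Finset.HasAntidiagonal.mem_antidiagonal.1 hij
      refine Ideal.pow_le_pow_right (m := m - T.sup natDegree)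
        (n := ij.1 + (ij.2 - T.sup natDegree)) (by omega) ?_
      rw [pow_add]
      exact Ideal.mul_mem_mul (d.2 _) (hy _)
  have h1 := hcoeff (monomial (n + T.sup natDegree) x)
    (hT ▸ isIntegral_reesAlgebra_of_mem_intClosure hx) (n + T.sup natDegree)
  rwa [coeff_monomial, if_pos rfl, Nat.add_sub_cancel] at h1

theorem AdmissibleDomain.finite_integralClosure_reesAlgebra {S : Type u} (L : Type u) [CommRing S]
    [IsDomain S] [IsNoetherianRing S] (hS : AdmissibleDomain S) {I : Ideal S} (hI : I ≠ ⊥)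
    [Field L] [Algebra S[X] L] [IsFractionRing S[X] L] :
    Module.Finite (reesAlgebra I) (integralClosure (reesAlgebra I) L) := by
  have hL := isFractionRing_reesAlgebra L hI
  rcases hS with ⟨-, m, hm, -, hc⟩ | ⟨⟨F⟩⟩ | hZ | ⟨⟨R⟩⟩
  · let _ := Ideal.Quotient.field m
    have hN := IsNagataRing.of_isAdicComplete m (IsNagataRing.of_field (S ⧸ m))
    exact hN.finite_integralClosure L
  · obtain ⟨F, hFS⟩ := F
    have hft : Algebra.FiniteType F (reesAlgebra I) := Algebra.FiniteType.trans hFS inferInstance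
    exact (IsNagataRing.of_field F).finite_integralClosure L
  · have hft : Algebra.FiniteType ℤ (reesAlgebra I) := Algebra.FiniteType.trans hZ inferInstance
    exact IsNagataRing.int.finite_integralClosure L
  · obtain ⟨R, hRS, hfin⟩ := R
    have hft : Algebra.FiniteType R (reesAlgebra I) := Algebra.FiniteType.trans hRS inferInstance
    have h1 := hfin (reesAlgebra I) hft
    exact Module.Finite.equiv
      (FractionRing.algEquiv (reesAlgebra I) L).mapIntegralClosure.toLinearEquiv

theorem asympResurgence_le_resurgence_of_le {S : Type u} [CommRing S] {a b b' : ℕ → Ideal S} {k : ℕ}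
    (hk : ∀ n, b' (n + k) ≤ b n) : asympResurgence a b ≤ resurgence a b' := by
  refine sSup_le ?_
  rintro _ ⟨s, r, hs, hr, hev, rfl⟩
  have hlim : Tendsto (fun t : ℕ => (((s * t : ℕ) : ℝ) / ((r * t + k : ℕ) : ℝ))) atTop
      (nhds ((s : ℝ) / r)) := by
    have hr' : (r : ℝ) + 0 ≠ 0 := by positivity
    have h1 := (tendsto_const_nhds (x := (s : ℝ))).div ((tendsto_const_nhds (x := (r : ℝ))).add
      (tendsto_const_div_atTop_nhds_zero_nat (k : ℝ))) hr'
    rw [add_zero] at h1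
    refine h1.congr' ?_
    filter_upwards [eventually_gt_atTop 0] with t ht
    have ht' : (t : ℝ) ≠ 0 := by positivity
    simp only [Pi.div_apply]
    push_cast
    field_simp
  refine le_of_tendsto ((continuous_coe_real_ereal.tendsto _).comp hlim) ?_
  filter_upwards [hev, eventually_gt_atTop 0] with t ht ht0
  refine le_sSup ⟨s * t, r * t + k, by positivity, by positivity,
    fun hle => ht (hle.trans (hk _)), rfl⟩

theorem GradedFamily.pow_mem {S : Type u} [CommRing S] {a : ℕ → Ideal S} (ha : GradedFamily a)
    {s : ℕ} {x : S} (hx : x ∈ a s) (t : ℕ) : x ^ t ∈ a (s * t) := by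
  induction t with
  | zero => simp [ha.1]
  | succ t ih =>
    rw [pow_succ, mul_add_one]
    exact ha.2 _ _ (Ideal.mul_mem_mul ih hx)

theorem asympResurgence_anti {S : Type u} [CommRing S] {a b b' : ℕ → Ideal S}
    (h : ∀ n, b n ≤ b' n) : asympResurgence a b' ≤ asympResurgence a b := by
  refine sSup_le_sSup ?_
  rintro _ ⟨s, r, hs, hr, hev, rfl⟩
  exact ⟨s, r, hs, hr, hev.mono fun t ht hle => ht (hle.trans (h _)), rfl⟩

theorem resurgence_intClosure_le_asympResurgence {S : Type u} [CommRing S] {a : ℕ → Ideal S}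
    (ha : GradedFamily a) (I : Ideal S) :
    resurgence a (fun i => intClosure (I ^ i)) ≤
      asympResurgence a (fun i => intClosure (I ^ i)) := by
  refine sSup_le_sSup ?_
  rintro _ ⟨s, r, hs, hr, hsr, rfl⟩
  refine ⟨s, r, hs, hr, ?_, rfl⟩
  obtain ⟨x, hx, hxr⟩ := SetLike.not_le_iff_exists.1 hsr
  filter_upwards [eventually_gt_atTop 0] with t ht hle
  exact hxr (mem_intClosure_of_pow_mem ht (hle (ha.pow_mem hx t)))

end ReesClosure

/-- **Corollary.** Let `S` be a domain which is a complete local Noetherian ring, or finitely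
generated over a field or `ℤ`, or more generally finitely generated over a Noetherian
integrally closed domain `R` such that every finitely generated `R`-algebra has module-finite
integral closure. Let `a` be a filtration of nonzero ideals and `bb` a nonzero ideal of `S`.
Then `ρ̂(a, bb^•) = ρ̂(a, overline{bb^•}) = ρ(a, overline{bb^•})`. -/
theorem statement10 {S : Type u} [CommRing S] [IsDomain S] [IsNoetherianRing S]
    (hS : AdmissibleDomain S)
    (a : ℕ → Ideal S) (ha : IdealFiltration a) (hanz : ∀ i : ℕ, 1 ≤ i → a i ≠ ⊥)
    (bb : Ideal S) (hbb : bb ≠ ⊥) :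
    asympResurgence a (fun i => bb ^ i) =
        asympResurgence a (fun i => intClosure (bb ^ i)) ∧
      asympResurgence a (fun i => intClosure (bb ^ i)) =
        resurgence a (fun i => intClosure (bb ^ i)) := by
  obtain ⟨k, hk⟩ := exists_intClosure_pow_le (FractionRing S[X])
    (hS.finite_integralClosure_reesAlgebra (FractionRing S[X]) hbb)
  have h1 : asympResurgence a (fun i => bb ^ i) ≤ resurgence a (fun i => intClosure (bb ^ i)) :=
    asympResurgence_le_resurgence_of_le hk
  have h2 := resurgence_intClosure_le_asympResurgence ha.1 bb
  have h3 : asympResurgence a (fun i => intClosure (bb ^ i)) ≤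
      asympResurgence a (fun i => bb ^ i) := asympResurgence_anti fun i => le_intClosure (bb ^ i)
  exact ⟨le_antisymm (h1.trans h2) h3, le_antisymm (h3.trans h1) h2⟩
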